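/- arXiv:1701.03370 — 15 statements merged into one kernel-verified Lean document; each statement's English description precedes it below -/
import Mathlib

section
/- (Proposition 3.1, constancy of the fluid total workload) For every fluid model solution Q̄ and every t ≥ 0, τ₁Q̄₁(t) + τ₂Q̄₂(t) = τ₁Q̄₁(0) + τ₂Q̄₂(0). -/
/-- Service allocation function `R` on `ℝ₊² \ {0}` (extended arbitrarily elsewhere). -/
noncomputable def Ralloc (K1 K2 : ℝ) (q : ℝ × ℝ) : ℝ × ℝ :=
  (if q.1 = 0 then 0 else min q.1 K1 / (min q.1 K1 + min q.2 K2),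
   if q.2 = 0 then 0 else min q.2 K2 / (min q.1 K1 + min q.2 K2))

/-- Drift field `Ψ(q) = λ − (I − Pᵀ)(μ ∘ R(q))`, written componentwise. -/
noncomputable def Psi (lam1 lam2 mu1 mu2 p11 p12 p21 p22 K1 K2 : ℝ) (q : ℝ × ℝ) : ℝ × ℝ :=
  (lam1 - (mu1 * (Ralloc K1 K2 q).1
      - (p11 * (mu1 * (Ralloc K1 K2 q).1) + p21 * (mu2 * (Ralloc K1 K2 q).2))),
   lam2 - (mu2 * (Ralloc K1 K2 q).2
      - (p12 * (mu1 * (Ralloc K1 K2 q).1) + p22 * (mu2 * (Ralloc K1 K2 q).2))))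

/-- A fluid model solution: a differentiable function `Q : [0,∞) → ℝ₊² \ {0}` with
`Q′(t) = Ψ(Q(t))` for all `t ≥ 0`. -/
def IsFluidSolution (lam1 lam2 mu1 mu2 p11 p12 p21 p22 K1 K2 : ℝ) (Q : ℝ → ℝ × ℝ) : Prop :=
  ∀ t : ℝ, 0 ≤ t → 0 ≤ (Q t).1 ∧ 0 ≤ (Q t).2 ∧ Q t ≠ 0 ∧
    HasDerivWithinAt Q (Psi lam1 lam2 mu1 mu2 p11 p12 p21 p22 K1 K2 (Q t)) (Set.Ici 0) t

/-- The service allocation uses the full capacity at every nonzero nonnegative state. -/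
theorem Ralloc_fst_add_snd {K1 K2 : ℝ} (hK1 : 0 < K1) (hK2 : 0 < K2) {q : ℝ × ℝ}
    (h1 : 0 ≤ q.1) (h2 : 0 ≤ q.2) (hq : q ≠ 0) :
    (Ralloc K1 K2 q).1 + (Ralloc K1 K2 q).2 = 1 := by
  have hR1 : (Ralloc K1 K2 q).1 = min q.1 K1 / (min q.1 K1 + min q.2 K2) := by
    by_cases h : q.1 = 0 <;> simp [Ralloc, h, hK1.le]
  have hR2 : (Ralloc K1 K2 q).2 = min q.2 K2 / (min q.1 K1 + min q.2 K2) := by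
    by_cases h : q.2 = 0 <;> simp [Ralloc, h, hK2.le]
  have hpos : 0 < min q.1 K1 + min q.2 K2 := by
    rcases h1.eq_or_lt with h | h
    · have h2' : 0 < q.2 := h2.lt_of_ne fun h' => hq (Prod.ext h.symm h'.symm)
      exact add_pos_of_nonneg_of_pos (le_min h1 hK1.le) (lt_min h2' hK2)
    · exact add_pos_of_pos_of_nonneg (lt_min h hK1) (le_min h2 hK2.le)
  rw [hR1, hR2, ← add_div, div_self hpos.ne']

/-- Proposition 3.1: under critical loading the fluid total workload
`τ₁Q̄₁(t) + τ₂Q̄₂(t)` is constant in time. -/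
theorem fluid_total_workload_constant
    (lam1 lam2 mu1 mu2 : ℝ)
    (hlam1 : 0 < lam1) (hlam2 : 0 < lam2) (hmu1 : 0 < mu1) (hmu2 : 0 < mu2)
    (p11 p12 p21 p22 : ℝ)
    (hp11 : 0 ≤ p11) (hp12 : 0 ≤ p12) (hp21 : 0 ≤ p21) (hp22 : 0 ≤ p22)
    (hrow1 : p11 + p12 ≤ 1) (hrow2 : p21 + p22 ≤ 1)
    (hspec : Filter.Tendsto
      (fun k : ℕ => (Matrix.of ![![p11, p12], ![p21, p22]] : Matrix (Fin 2) (Fin 2) ℝ) ^ k)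
      Filter.atTop (nhds 0))
    (gam1 gam2 : ℝ)
    (hgam1 : gam1 = lam1 + p11 * gam1 + p21 * gam2)
    (hgam2 : gam2 = lam2 + p12 * gam1 + p22 * gam2)
    (rho1 rho2 : ℝ) (hrho1 : rho1 = gam1 / mu1) (hrho2 : rho2 = gam2 / mu2)
    (tau1 tau2 : ℝ)
    (htau1 : tau1 = 1 / mu1 + p11 * tau1 + p12 * tau2)
    (htau2 : tau2 = 1 / mu2 + p21 * tau1 + p22 * tau2)
    (hcrit : rho1 + rho2 = 1)
    (K1 K2 : ℝ) (hK1 : 0 < K1) (hK2 : 0 < K2)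
    (hbot : rho1 / K1 > rho2 / K2)
    (Q : ℝ → ℝ × ℝ)
    (hQ : IsFluidSolution lam1 lam2 mu1 mu2 p11 p12 p21 p22 K1 K2 Q) :
    ∀ t : ℝ, 0 ≤ t →
      tau1 * (Q t).1 + tau2 * (Q t).2 = tau1 * (Q 0).1 + tau2 * (Q 0).2 := by
  have hload : tau1 * lam1 + tau2 * lam2 = 1 := by
    rw [hrho1, hrho2] at hcrit
    linear_combination hcrit - tau1 * hgam1 - tau2 * hgam2 + gam1 * htau1 + gam2 * htau2
  have hderiv : ∀ t : ℝ, 0 ≤ t →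
      HasDerivWithinAt (fun s => tau1 * (Q s).1 + tau2 * (Q s).2) 0 (Set.Ici 0) t := by
    intro t ht
    obtain ⟨h1, h2, hne, hd⟩ := hQ t ht
    have hsum := Ralloc_fst_add_snd hK1 hK2 h1 h2 hne
    have hd1 := (hasFDerivAt_fst (𝕜 := ℝ) (p := Q t)).comp_hasDerivWithinAt t hd
    have hd2 := (hasFDerivAt_snd (𝕜 := ℝ) (p := Q t)).comp_hasDerivWithinAt t hd
    refine ((hd1.const_mul tau1).add (hd2.const_mul tau2)).congr_deriv ?_
    have hb1 : mu1 * (1 / mu1) = 1 := mul_one_div_cancel hmu1.ne'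
    have hb2 : mu2 * (1 / mu2) = 1 := mul_one_div_cancel hmu2.ne'
    simp only [Psi, ContinuousLinearMap.coe_fst', ContinuousLinearMap.coe_snd']
    linear_combination hload - hsum - mu1 * (Ralloc K1 K2 (Q t)).1 * htau1
      - mu2 * (Ralloc K1 K2 (Q t)).2 * htau2
      - (Ralloc K1 K2 (Q t)).1 * hb1 - (Ralloc K1 K2 (Q t)).2 * hb2
  intro t ht
  exact constant_of_has_deriv_right_zero
    (fun s hs => (hderiv s hs.1).continuousWithinAt.mono Set.Icc_subset_Ici_self)
    (fun s hs => (hderiv s hs.1).mono (Set.Ici_subset_Ici.2 hs.1)) t ⟨ht, le_rfl⟩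
end

section
/- (Lemma 3.2, existence and uniqueness) For every q⁰ ∈ ℝ₊² \ {0} there exists exactly one fluid model solution Q̄ with Q̄(0) = q⁰; that is, there is a differentiable function Q̄ : [0,∞) → ℝ₊² \ {0} with Q̄(0) = q⁰ and Q̄′(t) = Ψ(Q̄(t)) for all t ≥ 0, and any two such functions coincide. -/
section ODEGlobal

open Set

variable {E : Type*} [NormedAddCommGroup E] [NormedSpace ℝ E]

/-- Forward uniqueness for an autonomous ODE with a Lipschitz vector field. -/
theorem eqOn_Icc_of_hasDerivWithinAt {F : E → E} {K : NNReal} (hF : LipschitzWith K F)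
    {f g : ℝ → E} {T : ℝ}
    (hf : ∀ t ∈ Icc 0 T, HasDerivWithinAt f (F (f t)) (Icc 0 T) t)
    (hg : ∀ t ∈ Icc 0 T, HasDerivWithinAt g (F (g t)) (Icc 0 T) t)
    (h0 : f 0 = g 0) : EqOn f g (Icc 0 T) := by
  have key : ∀ {h : ℝ → E}, (∀ t ∈ Icc 0 T, HasDerivWithinAt h (F (h t)) (Icc 0 T) t) →
      ∀ t ∈ Ico 0 T, HasDerivWithinAt h (F (h t)) (Ici t) t := fun hh t ht =>
    (hh t ⟨ht.1, ht.2.le⟩).mono_of_mem_nhdsWithin (Icc_mem_nhdsGE_of_mem ht)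
  exact ODE_solution_unique_of_mem_Icc_right (v := fun _ => F) (s := fun _ => univ) (K := K)
    (fun _ _ => hF.lipschitzOnWith) (fun t ht => (hf t ht).continuousWithinAt) (key hf)
    (fun _ _ => mem_univ _) (fun t ht => (hg t ht).continuousWithinAt) (key hg)
    (fun _ _ => mem_univ _) h0

/-- Global forward existence for an autonomous ODE with a bounded Lipschitz vector field. -/
theorem exists_forall_hasDerivWithinAt_Ici [CompleteSpace E] {F : E → E} {K L : NNReal}
    (hF : LipschitzWith K F) (hL : ∀ x, ‖F x‖ ≤ L) (x₀ : E) :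
    ∃ Q : ℝ → E, Q 0 = x₀ ∧ ∀ t, 0 ≤ t → HasDerivWithinAt Q (F (Q t)) (Ici 0) t := by
  have step (n : ℕ) : ∃ α : ℝ → E, α 0 = x₀ ∧
      ∀ t ∈ Icc (0 : ℝ) n, HasDerivWithinAt α (F (α t)) (Icc 0 n) t := by
    have hpl : IsPicardLindelof (fun _ => F) (tmin := 0) (tmax := n)
        ⟨0, le_rfl, n.cast_nonneg⟩ x₀ (L * n) 0 L K :=
      { lipschitzOnWith := fun _ _ => hF.lipschitzOnWith
        continuousOn := fun _ _ => continuousOn_const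
        norm_le := fun _ _ x _ => hL x
        mul_max_le := by simp }
    exact hpl.exists_eq_forall_mem_Icc_hasDerivWithinAt₀
  choose α hα0 hα using step
  have agree {m n : ℕ} (hmn : m ≤ n) : EqOn (α m) (α n) (Icc 0 m) := by
    have hsub : Icc (0 : ℝ) m ⊆ Icc 0 n := Icc_subset_Icc_right (by exact_mod_cast hmn)
    exact eqOn_Icc_of_hasDerivWithinAt hF (hα m)
      (fun t ht => (hα n t (hsub ht)).mono hsub) (by rw [hα0, hα0])
  have glue (N : ℕ) (s : ℝ) (hs : 0 ≤ s) (hsN : s < N) : α (⌊s⌋₊ + 1) s = α N s := by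
    refine agree ?_ ⟨hs, ?_⟩
    · exact (Nat.floor_lt hs).2 hsN
    · push_cast; exact (Nat.lt_floor_add_one s).le
  refine ⟨fun t => α (⌊t⌋₊ + 1) t, hα0 _, fun t ht => ?_⟩
  have htN : t < ((⌊t⌋₊ + 1 : ℕ) : ℝ) := by push_cast; exact Nat.lt_floor_add_one t
  have hmem : Icc (0 : ℝ) (⌊t⌋₊ + 1 : ℕ) ∈ nhdsWithin t (Ici 0) := by
    filter_upwards [self_mem_nhdsWithin, mem_nhdsWithin_of_mem_nhds (Iio_mem_nhds htN)]
      with s hs hs' using ⟨hs, le_of_lt hs'⟩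
  refine ((hα _ t ⟨ht, htN.le⟩).mono_of_mem_nhdsWithin hmem).congr_of_eventuallyEq ?_ rfl
  filter_upwards [self_mem_nhdsWithin, mem_nhdsWithin_of_mem_nhds (Iio_mem_nhds htN)]
    with s hs hs' using glue _ s hs hs'

end ODEGlobal

/-- Truncation of `x` to the interval `[0, K]`. -/
noncomputable def clip (K x : ℝ) : ℝ := max (min x K) 0

theorem clip_nonneg (K x : ℝ) : 0 ≤ clip K x := le_max_right _ _

theorem clip_of_nonneg {K x : ℝ} (hK : 0 < K) (hx : 0 ≤ x) : clip K x = min x K :=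
  max_eq_left (le_min hx hK.le)

theorem abs_clip_sub_clip_le (K x y : ℝ) : |clip K x - clip K y| ≤ |x - y| :=
  (abs_max_sub_max_le_abs _ _ _).trans (by
    simpa using abs_min_sub_min_le_max x K y K)

theorem abs_div_sub_div_le {a b a' b' c : ℝ} (hc : 0 < c) (hb : c ≤ b) (hb' : c ≤ b')
    (ha' : 0 ≤ a') (hab' : a' ≤ b') : |a / b - a' / b'| ≤ (|a - a'| + |b - b'|) / c := by
  have hbpos := hc.trans_le hb
  have hbpos' := hc.trans_le hb'
  have h : a / b - a' / b' = ((a - a') - a' / b' * (b - b')) / b := by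
    field_simp
    ring
  have hr : |a' / b'| ≤ 1 := by
    rw [abs_of_nonneg (by positivity)]
    exact div_le_one_of_le₀ hab' hbpos'.le
  rw [h, abs_div, abs_of_pos hbpos]
  gcongr
  refine (abs_sub _ _).trans ?_
  rw [abs_mul]
  gcongr
  exact mul_le_of_le_one_left (abs_nonneg _) hr

/-- The service allocation with clipped queue lengths and total service bounded below by `c`. -/
noncomputable def clippedAlloc (K1 K2 c : ℝ) (q : ℝ × ℝ) : ℝ × ℝ :=
  (clip K1 q.1 / max (clip K1 q.1 + clip K2 q.2) c,
   clip K2 q.2 / max (clip K1 q.1 + clip K2 q.2) c)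

section ClippedAlloc

variable {K1 K2 c : ℝ}

theorem clippedAlloc_nonneg (hc : 0 < c) (q : ℝ × ℝ) :
    0 ≤ (clippedAlloc K1 K2 c q).1 ∧ 0 ≤ (clippedAlloc K1 K2 c q).2 := by
  have hpos : 0 < max (clip K1 q.1 + clip K2 q.2) c := lt_max_of_lt_right hc
  exact ⟨div_nonneg (clip_nonneg _ _) hpos.le, div_nonneg (clip_nonneg _ _) hpos.le⟩

theorem clippedAlloc_sum_le_one (hc : 0 < c) (q : ℝ × ℝ) :
    (clippedAlloc K1 K2 c q).1 + (clippedAlloc K1 K2 c q).2 ≤ 1 := by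
  have hpos : 0 < max (clip K1 q.1 + clip K2 q.2) c := lt_max_of_lt_right hc
  simp only [clippedAlloc, ← add_div]
  exact div_le_one_of_le₀ (le_max_left _ _) hpos.le

theorem norm_clippedAlloc_le (hc : 0 < c) (q : ℝ × ℝ) : ‖clippedAlloc K1 K2 c q‖ ≤ 1 := by
  obtain ⟨h1, h2⟩ := clippedAlloc_nonneg (K1 := K1) (K2 := K2) hc q
  have h := clippedAlloc_sum_le_one (K1 := K1) (K2 := K2) hc q
  rw [Prod.norm_def, Real.norm_of_nonneg h1, Real.norm_of_nonneg h2]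
  exact max_le (by linarith) (by linarith)

theorem lipschitzWith_clippedAlloc (hc : 0 < c) :
    LipschitzWith (3 / c).toNNReal (clippedAlloc K1 K2 c) := by
  refine LipschitzWith.of_dist_le_mul fun q q' => ?_
  rw [Real.coe_toNNReal _ (by positivity)]
  have h1 : |clip K1 q.1 - clip K1 q'.1| ≤ dist q q' :=
    (abs_clip_sub_clip_le _ _ _).trans (by rw [Prod.dist_eq, Real.dist_eq]; exact le_max_left _ _)
  have h2 : |clip K2 q.2 - clip K2 q'.2| ≤ dist q q' :=
    (abs_clip_sub_clip_le _ _ _).trans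
      (by rw [Prod.dist_eq, ← Real.dist_eq]; exact le_max_right _ _)
  have hm : |max (clip K1 q.1 + clip K2 q.2) c - max (clip K1 q'.1 + clip K2 q'.2) c|
      ≤ 2 * dist q q' := by
    refine (abs_max_sub_max_le_abs _ _ _).trans ?_
    rw [add_sub_add_comm]
    exact (abs_add_le _ _).trans (by linarith)
  have n1 := clip_nonneg K1 q'.1
  have n2 := clip_nonneg K2 q'.2
  rw [Prod.dist_eq, Real.dist_eq, Real.dist_eq]
  refine max_le ?_ ?_
  · refine (abs_div_sub_div_le hc (le_max_right _ _) (le_max_right _ _) n1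
      (le_max_of_le_left (by linarith))).trans ?_
    rw [div_mul_eq_mul_div]
    gcongr
    linarith
  · refine (abs_div_sub_div_le hc (le_max_right _ _) (le_max_right _ _) n2
      (le_max_of_le_left (by linarith))).trans ?_
    rw [div_mul_eq_mul_div]
    gcongr
    linarith

theorem clippedAlloc_eq_Ralloc (hK1 : 0 < K1) (hK2 : 0 < K2) {q : ℝ × ℝ}
    (h1 : 0 ≤ q.1) (h2 : 0 ≤ q.2) (hq : c ≤ min q.1 K1 + min q.2 K2) :
    clippedAlloc K1 K2 c q = Ralloc K1 K2 q := by
  simp only [clippedAlloc, Ralloc, clip_of_nonneg hK1 h1, clip_of_nonneg hK2 h2, max_eq_left hq]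
  refine Prod.ext ?_ ?_
  · dsimp only
    split_ifs with h
    · simp [h, hK1.le]
    · rfl
  · dsimp only
    split_ifs with h
    · simp [h, hK2.le]
    · rfl

theorem Ralloc_sum_le_one (hK1 : 0 < K1) (hK2 : 0 < K2) {q : ℝ × ℝ}
    (h1 : 0 ≤ q.1) (h2 : 0 ≤ q.2) : (Ralloc K1 K2 q).1 + (Ralloc K1 K2 q).2 ≤ 1 := by
  have m1 : 0 ≤ min q.1 K1 := le_min h1 hK1.le
  have m2 : 0 ≤ min q.2 K2 := le_min h2 hK2.le
  have h : min q.1 K1 / (min q.1 K1 + min q.2 K2) + min q.2 K2 / (min q.1 K1 + min q.2 K2) ≤ 1 := by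
    rw [← add_div]
    exact div_self_le_one _
  have n1 : 0 ≤ min q.1 K1 / (min q.1 K1 + min q.2 K2) := by positivity
  have n2 : 0 ≤ min q.2 K2 / (min q.1 K1 + min q.2 K2) := by positivity
  simp only [Ralloc]
  split_ifs <;> linarith

/-- A lower bound on a positive workload keeps the total service bounded away from zero. -/
theorem le_min_add_min_of_workload_ge {tau1 tau2 w : ℝ} (hK1 : 0 < K1) (hK2 : 0 < K2)
    (ht1 : 0 < tau1) (ht2 : 0 < tau2) {q : ℝ × ℝ} (h1 : 0 ≤ q.1) (h2 : 0 ≤ q.2)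
    (hw : w ≤ tau1 * q.1 + tau2 * q.2) :
    min (w / (tau1 + tau2)) (min K1 K2) ≤ min q.1 K1 + min q.2 K2 := by
  have m1 : 0 ≤ min q.1 K1 := le_min h1 hK1.le
  have m2 : 0 ≤ min q.2 K2 := le_min h2 hK2.le
  have hmin1 : min (w / (tau1 + tau2)) (min K1 K2) ≤ K1 := (min_le_right _ _).trans (min_le_left _ _)
  have hmin2 : min (w / (tau1 + tau2)) (min K1 K2) ≤ K2 :=
    (min_le_right _ _).trans (min_le_right _ _)
  have hmin := min_le_left (w / (tau1 + tau2)) (min K1 K2)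
  rcases le_total q.1 q.2 with h | h
  · have : w / (tau1 + tau2) ≤ q.2 := by
      rw [div_le_iff₀ (by positivity)]
      nlinarith
    linarith [le_min (hmin.trans this) hmin2]
  · have : w / (tau1 + tau2) ≤ q.1 := by
      rw [div_le_iff₀ (by positivity)]
      nlinarith
    linarith [le_min (hmin.trans this) hmin1]

end ClippedAlloc

/-- The drift `λ − (I − Pᵀ)(μ ∘ r)` produced by the allocation `r`. -/
noncomputable def allocDrift (lam1 lam2 mu1 mu2 p11 p12 p21 p22 : ℝ) (r : ℝ × ℝ) : ℝ × ℝ :=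
  (lam1 - (mu1 * r.1 - (p11 * (mu1 * r.1) + p21 * (mu2 * r.2))),
   lam2 - (mu2 * r.2 - (p12 * (mu1 * r.1) + p22 * (mu2 * r.2))))

section Drift

open Set

theorem HasDerivWithinAt.prodFst {Q : ℝ → ℝ × ℝ} {v : ℝ × ℝ} {s : Set ℝ} {t : ℝ}
    (h : HasDerivWithinAt Q v s t) : HasDerivWithinAt (fun t => (Q t).1) v.1 s t := by
  simpa using h.hasFDerivWithinAt.fst.hasDerivWithinAt

theorem HasDerivWithinAt.prodSnd {Q : ℝ → ℝ × ℝ} {v : ℝ × ℝ} {s : Set ℝ} {t : ℝ}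
    (h : HasDerivWithinAt Q v s t) : HasDerivWithinAt (fun t => (Q t).2) v.2 s t := by
  simpa using h.hasFDerivWithinAt.snd.hasDerivWithinAt

variable {lam1 lam2 mu1 mu2 p11 p12 p21 p22 : ℝ}

theorem Psi_eq_allocDrift (K1 K2 : ℝ) (q : ℝ × ℝ) :
    Psi lam1 lam2 mu1 mu2 p11 p12 p21 p22 K1 K2 q =
      allocDrift lam1 lam2 mu1 mu2 p11 p12 p21 p22 (Ralloc K1 K2 q) := rfl

theorem exists_allocDrift_eq (lam1 lam2 mu1 mu2 p11 p12 p21 p22 : ℝ) :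
    ∃ A : ℝ × ℝ →L[ℝ] ℝ × ℝ, allocDrift lam1 lam2 mu1 mu2 p11 p12 p21 p22 =
      fun r => (lam1, lam2) - A r := by
  let F := ContinuousLinearMap.fst ℝ ℝ ℝ
  let S := ContinuousLinearMap.snd ℝ ℝ ℝ
  refine ⟨(mu1 • F - (p11 • mu1 • F + p21 • mu2 • S)).prod
    (mu2 • S - (p12 • mu1 • F + p22 • mu2 • S)), ?_⟩
  funext r
  simp [allocDrift, F, S]

/-- The workload is nondecreasing along curves driven by allocations of total at most one. -/
theorem workload_le {tau1 tau2 : ℝ}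
    (htau1 : mu1 * (tau1 - (p11 * tau1 + p12 * tau2)) = 1)
    (htau2 : mu2 * (tau2 - (p21 * tau1 + p22 * tau2)) = 1)
    (hlam : tau1 * lam1 + tau2 * lam2 = 1)
    {Q r : ℝ → ℝ × ℝ} (hr : ∀ t, 0 ≤ t → (r t).1 + (r t).2 ≤ 1)
    (hQ : ∀ t, 0 ≤ t → HasDerivWithinAt Q
      (allocDrift lam1 lam2 mu1 mu2 p11 p12 p21 p22 (r t)) (Ici 0) t) {t : ℝ} (ht : 0 ≤ t) :
    tau1 * (Q 0).1 + tau2 * (Q 0).2 ≤ tau1 * (Q t).1 + tau2 * (Q t).2 := by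
  have hd (s : ℝ) (hs : 0 ≤ s) : HasDerivWithinAt (fun s => tau1 * (Q s).1 + tau2 * (Q s).2)
      (1 - ((r s).1 + (r s).2)) (Ici 0) s := by
    have h := (((hQ s hs).prodFst).const_mul tau1).add (((hQ s hs).prodSnd).const_mul tau2)
    convert! h using 1
    simp only [allocDrift]
    linear_combination (-1 : ℝ) * hlam + (r s).1 * htau1 + (r s).2 * htau2
  have hmono := monotoneOn_of_hasDerivWithinAt_nonneg (convex_Ici (0 : ℝ))
    (fun s hs => (hd s hs).continuousWithinAt)
    (fun s hs => (hd s (interior_subset hs)).mono interior_subset)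
    (fun s hs => sub_nonneg.2 (hr s (interior_subset hs)))
  exact hmono self_mem_Ici ht ht

/-- A function whose right derivative is positive at its zeros stays nonnegative. -/
theorem nonneg_of_deriv_pos_of_eq_zero {f f' : ℝ → ℝ}
    (hf : ∀ t, 0 ≤ t → HasDerivWithinAt f (f' t) (Ici 0) t) (h0 : 0 ≤ f 0)
    (hpos : ∀ t, 0 ≤ t → f t = 0 → 0 < f' t) {t : ℝ} (ht : 0 ≤ t) : 0 ≤ f t := by
  have h := image_le_of_deriv_right_lt_deriv_boundary' (f := fun _ => (0 : ℝ)) (f' := fun _ => 0)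
    (a := 0) (b := t) continuousOn_const (fun _ _ => hasDerivWithinAt_const _ _ _) (B := f)
    (B' := f') h0
    (fun s hs => (hf s hs.1).continuousWithinAt.mono Icc_subset_Ici_self)
    (fun s hs => (hf s hs.1).mono (Ici_subset_Ici.2 hs.1))
    (fun s hs h => hpos s hs.1 h.symm)
  exact h ⟨ht, le_rfl⟩

/-- A fixed point `τ = β + Pτ` with `β > 0` and `P` substochastic is positive. -/
theorem pos_and_pos_of_eq_add_substochastic {b1 b2 tau1 tau2 : ℝ} (hb1 : 0 < b1) (hb2 : 0 < b2)
    (hp12 : 0 ≤ p12) (hp21 : 0 ≤ p21)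
    (hrow1 : p11 + p12 ≤ 1) (hrow2 : p21 + p22 ≤ 1)
    (htau1 : tau1 = b1 + p11 * tau1 + p12 * tau2)
    (htau2 : tau2 = b2 + p21 * tau1 + p22 * tau2) : 0 < tau1 ∧ 0 < tau2 := by
  rcases le_total tau1 tau2 with h | h
  · have : 0 < tau1 := by
      by_contra! hn
      nlinarith [mul_le_mul_of_nonneg_left h hp12, mul_nonneg_of_nonpos_of_nonpos hn
        (sub_nonpos.2 hrow1)]
    exact ⟨this, this.trans_le h⟩
  · have : 0 < tau2 := by
      by_contra! hn
      nlinarith [mul_le_mul_of_nonneg_left h hp21, mul_nonneg_of_nonpos_of_nonpos hn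
        (sub_nonpos.2 hrow2)]
    exact ⟨this.trans_le h, this⟩

end Drift

/-- Lemma 3.2: existence and uniqueness of fluid model solutions for every
nonzero nonnegative initial state. -/
theorem fluid_solution_exists_unique
    (lam1 lam2 mu1 mu2 : ℝ)
    (hlam1 : 0 < lam1) (hlam2 : 0 < lam2) (hmu1 : 0 < mu1) (hmu2 : 0 < mu2)
    (p11 p12 p21 p22 : ℝ)
    (hp11 : 0 ≤ p11) (hp12 : 0 ≤ p12) (hp21 : 0 ≤ p21) (hp22 : 0 ≤ p22)
    (hrow1 : p11 + p12 ≤ 1) (hrow2 : p21 + p22 ≤ 1)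
    (hspec : Filter.Tendsto
      (fun k : ℕ => (Matrix.of ![![p11, p12], ![p21, p22]] : Matrix (Fin 2) (Fin 2) ℝ) ^ k)
      Filter.atTop (nhds 0))
    (gam1 gam2 : ℝ)
    (hgam1 : gam1 = lam1 + p11 * gam1 + p21 * gam2)
    (hgam2 : gam2 = lam2 + p12 * gam1 + p22 * gam2)
    (rho1 rho2 : ℝ) (hrho1 : rho1 = gam1 / mu1) (hrho2 : rho2 = gam2 / mu2)
    (tau1 tau2 : ℝ)
    (htau1 : tau1 = 1 / mu1 + p11 * tau1 + p12 * tau2)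
    (htau2 : tau2 = 1 / mu2 + p21 * tau1 + p22 * tau2)
    (hcrit : rho1 + rho2 = 1)
    (K1 K2 : ℝ) (hK1 : 0 < K1) (hK2 : 0 < K2)
    (hbot : rho1 / K1 > rho2 / K2)
    (q0 : ℝ × ℝ) (hq01 : 0 ≤ q0.1) (hq02 : 0 ≤ q0.2) (hq0 : q0 ≠ 0) :
    (∃ Q : ℝ → ℝ × ℝ,
        IsFluidSolution lam1 lam2 mu1 mu2 p11 p12 p21 p22 K1 K2 Q ∧ Q 0 = q0) ∧
    (∀ Q1 Q2 : ℝ → ℝ × ℝ,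
        IsFluidSolution lam1 lam2 mu1 mu2 p11 p12 p21 p22 K1 K2 Q1 →
        IsFluidSolution lam1 lam2 mu1 mu2 p11 p12 p21 p22 K1 K2 Q2 →
        Q1 0 = q0 → Q2 0 = q0 → ∀ t : ℝ, 0 ≤ t → Q1 t = Q2 t) := by
  have htau1' : mu1 * (tau1 - (p11 * tau1 + p12 * tau2)) = 1 := by
    have : tau1 - (p11 * tau1 + p12 * tau2) = 1 / mu1 := by linarith
    rw [this]
    field_simp
  have htau2' : mu2 * (tau2 - (p21 * tau1 + p22 * tau2)) = 1 := by
    have : tau2 - (p21 * tau1 + p22 * tau2) = 1 / mu2 := by linarith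
    rw [this]
    field_simp
  have hlam : tau1 * lam1 + tau2 * lam2 = 1 := by
    have e1 : gam1 * (1 / mu1) = rho1 := by rw [hrho1]; ring
    have e2 : gam2 * (1 / mu2) = rho2 := by rw [hrho2]; ring
    linear_combination (-tau1) * hgam1 - tau2 * hgam2 + gam1 * htau1 + gam2 * htau2 + e1 + e2
      + hcrit
  obtain ⟨ht1, ht2⟩ := pos_and_pos_of_eq_add_substochastic (one_div_pos.2 hmu1)
    (one_div_pos.2 hmu2) hp12 hp21 hrow1 hrow2 htau1 htau2
  have hw0 : 0 < tau1 * q0.1 + tau2 * q0.2 := by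
    rcases hq01.lt_or_eq with h | h
    · positivity
    · have : 0 < q0.2 := hq02.lt_of_ne fun h' => hq0 (Prod.ext h.symm h'.symm)
      positivity
  set w := tau1 * q0.1 + tau2 * q0.2 with hw
  set c := min (w / (tau1 + tau2)) (min K1 K2) with hc_def
  have hc : 0 < c := lt_min (by positivity) (lt_min hK1 hK2)
  obtain ⟨A, hA⟩ := exists_allocDrift_eq lam1 lam2 mu1 mu2 p11 p12 p21 p22
  have hlip : LipschitzWith (0 + ‖A‖₊ * (3 / c).toNNReal) fun q =>
      allocDrift lam1 lam2 mu1 mu2 p11 p12 p21 p22 (clippedAlloc K1 K2 c q) := by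
    rw [hA]
    exact (LipschitzWith.const _).sub (A.lipschitz.comp (lipschitzWith_clippedAlloc hc))
  refine ⟨?_, fun Q1 Q2 h1 h2 h10 h20 t ht => ?_⟩
  · have hbdd (q : ℝ × ℝ) : ‖allocDrift lam1 lam2 mu1 mu2 p11 p12 p21 p22
        (clippedAlloc K1 K2 c q)‖ ≤ (‖((lam1, lam2) : ℝ × ℝ)‖₊ + ‖A‖₊ : NNReal) := by
      rw [hA, NNReal.coe_add, coe_nnnorm, coe_nnnorm]
      refine (norm_sub_le _ _).trans (add_le_add_right ?_ _)
      exact (A.le_opNorm _).trans (mul_le_of_le_one_right (norm_nonneg _) (norm_clippedAlloc_le hc q))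
    obtain ⟨Q, hQ0, hQ⟩ := exists_forall_hasDerivWithinAt_Ici hlip hbdd q0
    refine ⟨Q, fun t ht => ?_, hQ0⟩
    have hr (t : ℝ) := clippedAlloc_nonneg (K1 := K1) (K2 := K2) hc (Q t)
    have n1 : 0 ≤ (Q t).1 := by
      refine nonneg_of_deriv_pos_of_eq_zero (fun s hs => (hQ s hs).prodFst) (by rwa [hQ0])
        (fun s _ hs0 => ?_) ht
      have hz : (clippedAlloc K1 K2 c (Q s)).1 = 0 := by simp [clippedAlloc, clip, hs0, hK1.le]
      have := mul_nonneg hp21 (mul_nonneg hmu2.le (hr s).2)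
      simp only [allocDrift, hz]
      linarith
    have n2 : 0 ≤ (Q t).2 := by
      refine nonneg_of_deriv_pos_of_eq_zero (fun s hs => (hQ s hs).prodSnd) (by rwa [hQ0])
        (fun s _ hs0 => ?_) ht
      have hz : (clippedAlloc K1 K2 c (Q s)).2 = 0 := by simp [clippedAlloc, clip, hs0, hK2.le]
      have := mul_nonneg hp12 (mul_nonneg hmu1.le (hr s).1)
      simp only [allocDrift, hz]
      linarith
    have hwork := workload_le htau1' htau2' hlam
      (fun s _ => clippedAlloc_sum_le_one hc (Q s)) hQ ht
    rw [hQ0, ← hw] at hwork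
    refine ⟨n1, n2, fun h => ?_, ?_⟩
    · simp only [h, Prod.fst_zero, Prod.snd_zero, mul_zero, add_zero] at hwork
      linarith
    · rw [Psi_eq_allocDrift, ← clippedAlloc_eq_Ralloc hK1 hK2 n1 n2
        (le_min_add_min_of_workload_ge hK1 hK2 ht1 ht2 n1 n2 hwork)]
      exact hQ t ht
  · have key {Q : ℝ → ℝ × ℝ}
        (h : IsFluidSolution lam1 lam2 mu1 mu2 p11 p12 p21 p22 K1 K2 Q) (h0 : Q 0 = q0) :
        ∀ s ∈ Set.Icc 0 t, HasDerivWithinAt Q (allocDrift lam1 lam2 mu1 mu2 p11 p12 p21 p22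
          (clippedAlloc K1 K2 c (Q s))) (Set.Icc 0 t) s := by
      intro s hs
      obtain ⟨n1, n2, -, hd⟩ := h s hs.1
      have hwork := workload_le htau1' htau2' hlam
        (fun s hs => Ralloc_sum_le_one hK1 hK2 (h s hs).1 (h s hs).2.1)
        (fun s hs => (h s hs).2.2.2) hs.1
      rw [h0, ← hw] at hwork
      rw [clippedAlloc_eq_Ralloc hK1 hK2 n1 n2
        (le_min_add_min_of_workload_ge hK1 hK2 ht1 ht2 n1 n2 hwork), ← Psi_eq_allocDrift]
      exact hd.mono Set.Icc_subset_Ici_self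
    exact eqOn_Icc_of_hasDerivWithinAt hlip (key h1 h10) (key h2 h20) (h10.trans h20.symm)
      ⟨ht, le_rfl⟩
end

section
/- (Proposition 3.3, characterization of constant solutions) Let Q̄ be a fluid model solution. Then Q̄(t) = Q̄(0) for all t ≥ 0 if and only if Q̄(0) belongs to the invariant manifold I. -/
/-- Powers of a matrix tending to zero exclude the eigenvalue `1`. -/
lemma Matrix.det_one_sub_ne_zero_of_tendsto_pow {n : Type*} [Fintype n] [DecidableEq n]
    {A : Matrix n n ℝ} (h : Filter.Tendsto (fun k : ℕ => A ^ k) Filter.atTop (nhds 0)) :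
    (1 - A).det ≠ 0 := by
  intro hdet
  obtain ⟨x, hx, hAx⟩ := Matrix.exists_mulVec_eq_zero_iff.mpr hdet
  rw [Matrix.sub_mulVec, Matrix.one_mulVec, sub_eq_zero] at hAx
  have hpow : ∀ k : ℕ, (A ^ k).mulVec x = x := by
    intro k
    induction k with
    | zero => simp
    | succ k ih => rw [pow_succ, ← Matrix.mulVec_mulVec, ← hAx, ih]
  have hlim : Filter.Tendsto (fun k : ℕ => (A ^ k).mulVec x) Filter.atTop
      (nhds ((0 : Matrix n n ℝ).mulVec x)) :=
    ((continuous_id.matrix_mulVec continuous_const).tendsto (0 : Matrix n n ℝ)).comp h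
  simp only [hpow, Matrix.zero_mulVec] at hlim
  exact hx (tendsto_nhds_unique tendsto_const_nhds hlim)

lemma min_add_min_pos {K1 K2 : ℝ} (hK1 : 0 < K1) (hK2 : 0 < K2) {q : ℝ × ℝ}
    (h1 : 0 ≤ q.1) (h2 : 0 ≤ q.2) (hq : q ≠ 0) : 0 < min q.1 K1 + min q.2 K2 := by
  rcases h1.eq_or_lt with h | h
  · have h2' : 0 < q.2 := h2.lt_of_ne fun h' => hq (Prod.ext h.symm h'.symm)
    exact add_pos_of_nonneg_of_pos (le_min h1 hK1.le) (lt_min h2' hK2)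
  · exact add_pos_of_pos_of_nonneg (lt_min h hK1) (le_min h2 hK2.le)

/-- The allocation is the ratio of truncated queue lengths, also on the axes. -/
lemma Ralloc_eq {K1 K2 : ℝ} (hK1 : 0 < K1) (hK2 : 0 < K2) (q : ℝ × ℝ) :
    Ralloc K1 K2 q = (min q.1 K1 / (min q.1 K1 + min q.2 K2),
      min q.2 K2 / (min q.1 K1 + min q.2 K2)) := by
  unfold Ralloc
  ext <;> dsimp only <;> split_ifs with h <;> simp [h, hK1.le, hK2.le]

/-- At critical loading the drift always points along one fixed direction. -/
lemma Psi_eq_smul {lam1 lam2 mu1 mu2 p11 p12 p21 p22 rho1 rho2 K1 K2 : ℝ}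
    (hlam1 : mu1 * rho1 = lam1 + p11 * (mu1 * rho1) + p21 * (mu2 * rho2))
    (hlam2 : mu2 * rho2 = lam2 + p12 * (mu1 * rho1) + p22 * (mu2 * rho2))
    (hcrit : rho1 + rho2 = 1) (hK1 : 0 < K1) (hK2 : 0 < K2) {q : ℝ × ℝ}
    (h1 : 0 ≤ q.1) (h2 : 0 ≤ q.2) (hq : q ≠ 0) :
    Psi lam1 lam2 mu1 mu2 p11 p12 p21 p22 K1 K2 q =
      ((rho1 * min q.2 K2 - rho2 * min q.1 K1) / (min q.1 K1 + min q.2 K2)) •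
        ((1 - p11) * mu1 + p21 * mu2, -((1 - p22) * mu2 + p12 * mu1)) := by
  have hpos := min_add_min_pos hK1 hK2 h1 h2 hq
  obtain rfl : rho2 = 1 - rho1 := by linarith
  rw [Psi, Ralloc_eq hK1 hK2]
  generalize min q.1 K1 = a at *
  generalize min q.2 K2 = b at *
  have e1 : a / (a + b) = rho1 - (rho1 * b - (1 - rho1) * a) / (a + b) := by
    field_simp; ring
  have e2 : b / (a + b) = 1 - rho1 + (rho1 * b - (1 - rho1) * a) / (a + b) := by
    field_simp; ring
  ext
  · simp only [Prod.smul_mk, smul_eq_mul, e1, e2]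
    linear_combination -hlam1
  · simp only [Prod.smul_mk, smul_eq_mul, e1, e2]
    linear_combination -hlam2

/-- The truncation at `K2` is inactive on the invariant manifold. -/
lemma balanced_iff_mem_manifold {rho1 rho2 K1 K2 : ℝ} (hr1 : 0 < rho1) (hr2 : 0 ≤ rho2)
    (hK1 : 0 < K1) (hK2 : 0 < K2) (hbot : rho1 / K1 > rho2 / K2) (q : ℝ × ℝ) :
    rho1 * min q.2 K2 - rho2 * min q.1 K1 = 0 ↔ q.2 = rho2 / rho1 * min q.1 K1 := by
  have hlt : rho2 / rho1 * min q.1 K1 < K2 := by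
    calc rho2 / rho1 * min q.1 K1 ≤ rho2 / rho1 * K1 := by gcongr; exact min_le_right _ _
      _ < K2 := by
        rw [gt_iff_lt, div_lt_div_iff₀ hK2 hK1] at hbot
        rw [div_mul_eq_mul_div, div_lt_iff₀ hr1]
        linarith
  have hbal : rho1 * min q.2 K2 - rho2 * min q.1 K1 = 0 ↔
      min q.2 K2 = rho2 / rho1 * min q.1 K1 := by
    rw [sub_eq_zero, div_mul_eq_mul_div, eq_div_iff hr1.ne', mul_comm rho1]
  rw [hbal]
  constructor
  · intro h
    rcases min_choice q.2 K2 with h' | h'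
    · rw [← h, h']
    · rw [← h, h'] at hlt
      exact absurd hlt (lt_irrefl _)
  · intro h
    rw [← h, min_eq_left (h ▸ hlt).le]

/-- A trajectory moving along a fixed direction whose speed opposes the displacement of the first
coordinate stays at its starting point. -/
lemma eq_initial_of_hasDerivWithinAt_smul {Q : ℝ → ℝ × ℝ} {g : ℝ → ℝ} {v1 v2 : ℝ} (hv1 : 0 < v1)
    (hQ : ∀ t, 0 ≤ t → HasDerivWithinAt Q (g t • (v1, v2)) (Set.Ici 0) t)
    (hg : ∀ t, 0 ≤ t → v1 * ((Q t).2 - (Q 0).2) = v2 * ((Q t).1 - (Q 0).1) →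
      ((Q t).1 - (Q 0).1) * g t ≤ 0) {t : ℝ} (ht : 0 ≤ t) : Q t = Q 0 := by
  have hd1 : ∀ t, 0 ≤ t → HasDerivWithinAt (fun s => (Q s).1) (g t * v1) (Set.Ici 0) t :=
    fun t ht => by
      simpa using! (HasFDerivWithinAt.fst (hQ t ht).hasFDerivWithinAt).hasDerivWithinAt
  have hd2 : ∀ t, 0 ≤ t → HasDerivWithinAt (fun s => (Q s).2) (g t * v2) (Set.Ici 0) t :=
    fun t ht => by
      simpa using! (HasFDerivWithinAt.snd (hQ t ht).hasFDerivWithinAt).hasDerivWithinAt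
  have hline : ∀ t, 0 ≤ t → v1 * ((Q t).2 - (Q 0).2) = v2 * ((Q t).1 - (Q 0).1) := by
    intro t ht
    have hd : ∀ s, 0 ≤ s →
        HasDerivWithinAt (fun s => v1 * (Q s).2 - v2 * (Q s).1) 0 (Set.Ici 0) s := by
      intro s hs
      exact (((hd2 s hs).const_mul v1).sub ((hd1 s hs).const_mul v2)).congr_deriv (by ring)
    have := constant_of_has_deriv_right_zero (a := 0) (b := t)
      (fun s hs => ((hd s hs.1).continuousWithinAt).mono Set.Icc_subset_Ici_self)
      (fun s hs => (hd s hs.1).mono (Set.Ici_subset_Ici.mpr hs.1)) t ⟨ht, le_rfl⟩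
    linarith
  have hdV : ∀ t, 0 ≤ t → HasDerivWithinAt (fun s => ((Q s).1 - (Q 0).1) ^ 2)
      (2 * v1 * (((Q t).1 - (Q 0).1) * g t)) (Set.Ici 0) t := by
    intro t ht
    exact (((hd1 t ht).sub_const (Q 0).1).pow 2).congr_deriv (by push_cast; ring)
  have hanti : AntitoneOn (fun s => ((Q s).1 - (Q 0).1) ^ 2) (Set.Ici 0) :=
    antitoneOn_of_hasDerivWithinAt_nonpos (convex_Ici 0)
      (fun s hs => (hdV s hs).continuousWithinAt)
      (fun s hs => (hdV s (interior_subset hs)).mono interior_subset)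
      (fun s hs => mul_nonpos_of_nonneg_of_nonpos (by positivity)
        (hg s (interior_subset hs) (hline s (interior_subset hs))))
  have hV : ((Q t).1 - (Q 0).1) ^ 2 ≤ 0 := by
    simpa using hanti (Set.mem_Ici.mpr le_rfl) (Set.mem_Ici.mpr ht) ht
  have h1 : (Q t).1 - (Q 0).1 = 0 := pow_eq_zero_iff two_ne_zero |>.mp (le_antisymm hV (sq_nonneg _))
  have h2 := hline t ht
  rw [h1, mul_zero, mul_eq_zero, or_iff_right hv1.ne'] at h2
  exact Prod.ext (sub_eq_zero.mp h1) (sub_eq_zero.mp h2)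

/-- Proposition 3.3: a fluid model solution is constant iff it starts on the
invariant manifold `I = {x ∈ ℝ₊² : x₂ = (ρ₂/ρ₁)·min(x₁,K₁)}`. -/
theorem fluid_constant_iff_invariant
    (lam1 lam2 mu1 mu2 : ℝ)
    (hlam1 : 0 < lam1) (hlam2 : 0 < lam2) (hmu1 : 0 < mu1) (hmu2 : 0 < mu2)
    (p11 p12 p21 p22 : ℝ)
    (hp11 : 0 ≤ p11) (hp12 : 0 ≤ p12) (hp21 : 0 ≤ p21) (hp22 : 0 ≤ p22)
    (hrow1 : p11 + p12 ≤ 1) (hrow2 : p21 + p22 ≤ 1)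
    (hspec : Filter.Tendsto
      (fun k : ℕ => (Matrix.of ![![p11, p12], ![p21, p22]] : Matrix (Fin 2) (Fin 2) ℝ) ^ k)
      Filter.atTop (nhds 0))
    (gam1 gam2 : ℝ)
    (hgam1 : gam1 = lam1 + p11 * gam1 + p21 * gam2)
    (hgam2 : gam2 = lam2 + p12 * gam1 + p22 * gam2)
    (rho1 rho2 : ℝ) (hrho1 : rho1 = gam1 / mu1) (hrho2 : rho2 = gam2 / mu2)
    (tau1 tau2 : ℝ)
    (htau1 : tau1 = 1 / mu1 + p11 * tau1 + p12 * tau2)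
    (htau2 : tau2 = 1 / mu2 + p21 * tau1 + p22 * tau2)
    (hcrit : rho1 + rho2 = 1)
    (K1 K2 : ℝ) (hK1 : 0 < K1) (hK2 : 0 < K2)
    (hbot : rho1 / K1 > rho2 / K2)
    (Q : ℝ → ℝ × ℝ)
    (hQ : IsFluidSolution lam1 lam2 mu1 mu2 p11 p12 p21 p22 K1 K2 Q) :
    (∀ t : ℝ, 0 ≤ t → Q t = Q 0) ↔ (Q 0).2 = rho2 / rho1 * min (Q 0).1 K1 := by
  have hdet := Matrix.det_one_sub_ne_zero_of_tendsto_pow hspec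
  have hD : 0 < (1 - p11) * (1 - p22) - p12 * p21 := by
    refine lt_of_le_of_ne ?_ fun h => hdet ?_
    · nlinarith [mul_le_mul (by linarith : p12 ≤ 1 - p11) (by linarith : p21 ≤ 1 - p22) hp21
        (by linarith)]
    · simp only [Matrix.det_fin_two, Matrix.sub_apply, Matrix.of_apply, Matrix.cons_val_zero,
        Matrix.cons_val_one, Matrix.one_apply_eq, ne_eq, zero_ne_one, one_ne_zero,
        not_false_eq_true, Matrix.one_apply_ne]
      linarith
  have hq1 : 0 < 1 - p11 := by
    refine lt_of_le_of_ne (by linarith) fun h => ?_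
    rw [← h] at hD
    nlinarith [mul_nonneg hp12 hp21]
  have hq2 : 0 < 1 - p22 := by
    refine lt_of_le_of_ne (by linarith) fun h => ?_
    rw [← h] at hD
    nlinarith [mul_nonneg hp12 hp21]
  have hg1 : 0 < gam1 := by
    refine pos_of_mul_pos_left (b := (1 - p11) * (1 - p22) - p12 * p21) ?_ hD.le
    have : gam1 * ((1 - p11) * (1 - p22) - p12 * p21) = lam1 * (1 - p22) + p21 * lam2 := by
      linear_combination (1 - p22) * hgam1 + p21 * hgam2
    rw [this]
    positivity
  have hg2 : 0 < gam2 := by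
    refine pos_of_mul_pos_left (b := (1 - p11) * (1 - p22) - p12 * p21) ?_ hD.le
    have : gam2 * ((1 - p11) * (1 - p22) - p12 * p21) = lam2 * (1 - p11) + p12 * lam1 := by
      linear_combination (1 - p11) * hgam2 + p12 * hgam1
    rw [this]
    positivity
  have hr1 : 0 < rho1 := hrho1 ▸ div_pos hg1 hmu1
  have hr2 : 0 < rho2 := hrho2 ▸ div_pos hg2 hmu2
  have e1 : mu1 * rho1 = gam1 := by rw [hrho1, mul_div_cancel₀ _ hmu1.ne']
  have e2 : mu2 * rho2 = gam2 := by rw [hrho2, mul_div_cancel₀ _ hmu2.ne']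
  rw [← e1, ← e2] at hgam1 hgam2
  have hv1 : 0 < (1 - p11) * mu1 + p21 * mu2 := by positivity
  have hv2 : 0 < (1 - p22) * mu2 + p12 * mu1 := by positivity
  have hderiv := fun t ht => (hQ t ht).2.2.2
  have hPsi := fun t ht => Psi_eq_smul hgam1 hgam2 hcrit hK1 hK2
    (hQ t ht).1 (hQ t ht).2.1 (hQ t ht).2.2.1
  have hpos := fun t ht => min_add_min_pos hK1 hK2 (hQ t ht).1 (hQ t ht).2.1 (hQ t ht).2.2.1
  rw [← balanced_iff_mem_manifold hr1 hr2.le hK1 hK2 hbot]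
  constructor
  · intro hconst
    have h0 : HasDerivWithinAt Q 0 (Set.Ici 0) 0 :=
      (hasDerivWithinAt_const (0 : ℝ) (Set.Ici 0) (Q 0)).congr (fun t ht => hconst t ht) rfl
    have hz := (uniqueDiffOn_Ici (0 : ℝ) 0 Set.self_mem_Ici).eq_deriv _ (hderiv 0 le_rfl) h0
    rw [hPsi 0 le_rfl] at hz
    have hz1 := congrArg Prod.fst hz
    simpa [hv1.ne', (hpos 0 le_rfl).ne'] using hz1
  · intro hbal t ht
    refine eq_initial_of_hasDerivWithinAt_smul hv1
      (fun s hs => hPsi s hs ▸ hderiv s hs) (fun s hs hline => ?_) ht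
    rcases le_total (Q 0).1 (Q s).1 with h | h
    · have h2 : (Q s).2 ≤ (Q 0).2 := by nlinarith
      have m1 := mul_le_mul_of_nonneg_left (min_le_min_right K1 h) hr2.le
      have m2 := mul_le_mul_of_nonneg_left (min_le_min_right K2 h2) hr1.le
      exact mul_nonpos_of_nonneg_of_nonpos (by linarith)
        (div_nonpos_of_nonpos_of_nonneg (by linarith) (hpos s hs).le)
    · have h2 : (Q 0).2 ≤ (Q s).2 := by nlinarith
      have m1 := mul_le_mul_of_nonneg_left (min_le_min_right K1 h) hr2.le
      have m2 := mul_le_mul_of_nonneg_left (min_le_min_right K2 h2) hr1.le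
      exact mul_nonpos_of_nonpos_of_nonneg (by linarith)
        (div_nonneg (by linarith) (hpos s hs).le)
end

section
/- (Characterization of the zeros of the drift field) For every x ∈ ℝ₊² \ {0} the following are equivalent: (i) Ψ(x) = 0; (ii) μᵢRᵢ(x) = γᵢ for i = 1,2; (iii) x ∈ I, i.e. x₂ = (ρ₂/ρ₁)·min(x₁,K₁). Moreover, every x ∈ I satisfies x₂ ≤ (ρ₂/ρ₁)K₁ < K₂; in particular every zero of Ψ has second coordinate strictly below K₂. -/
/-- If `P` is entrywise nonnegative with powers tending to `0`, then every row vector `y`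
with `y P ≤ y` is nonnegative. -/
theorem nonneg_of_vecMul_le {n : Type*} [Fintype n] [DecidableEq n] {P : Matrix n n ℝ}
    (hP : ∀ i j, 0 ≤ P i j)
    (hpow : Filter.Tendsto (fun k : ℕ => P ^ k) Filter.atTop (nhds 0))
    {y : n → ℝ} (hy : ∀ j, Matrix.vecMul y P j ≤ y j) (j : n) : 0 ≤ y j := by
  have hle : ∀ (k : ℕ) (j : n), Matrix.vecMul y (P ^ k) j ≤ y j := by
    intro k
    induction k with
    | zero => simp
    | succ k ih =>
      intro j
      rw [pow_succ, ← Matrix.vecMul_vecMul]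
      refine le_trans ?_ (hy j)
      exact Finset.sum_le_sum fun i _ => mul_le_mul_of_nonneg_right (ih i) (hP i j)
  have hcont : Continuous fun Q : Matrix n n ℝ => Matrix.vecMul y Q j := by fun_prop
  have hlim := (hcont.tendsto 0).comp hpow
  simp only [Matrix.vecMul_zero, Pi.zero_apply] at hlim
  exact le_of_tendsto' hlim fun k => hle k j

/-- The two-dimensional case of `nonneg_of_vecMul_le`, in coordinates. -/
theorem nonneg_of_vecMul_le_fin_two {p11 p12 p21 p22 : ℝ}
    (hp11 : 0 ≤ p11) (hp12 : 0 ≤ p12) (hp21 : 0 ≤ p21) (hp22 : 0 ≤ p22)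
    (hpow : Filter.Tendsto
      (fun k : ℕ => (Matrix.of ![![p11, p12], ![p21, p22]] : Matrix (Fin 2) (Fin 2) ℝ) ^ k)
      Filter.atTop (nhds 0))
    {a b : ℝ} (ha : p11 * a + p21 * b ≤ a) (hb : p12 * a + p22 * b ≤ b) :
    0 ≤ a ∧ 0 ≤ b := by
  have h := nonneg_of_vecMul_le (y := ![a, b])
    (by intro i j; fin_cases i <;> fin_cases j <;> simpa) hpow (by
      intro j
      fin_cases j <;> simp [Matrix.vecMul, dotProduct, Fin.sum_univ_two] <;> linarith)
  exact ⟨by simpa using h 0, by simpa using h 1⟩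

/-- The allocation `R` takes a value `(r₁, r₂)` with positive entries of sum `1` and
`r₂ / r₁ * K₁ < K₂` exactly on the curve `x₂ = (r₂ / r₁) min(x₁, K₁)`. -/
theorem Ralloc_eq_iff {K1 K2 r1 r2 : ℝ} (hK1 : 0 < K1) (hK2 : 0 < K2)
    (hr1 : 0 < r1) (hr2 : 0 < r2) (hr : r1 + r2 = 1) (hK : r2 / r1 * K1 < K2)
    {x : ℝ × ℝ} (hx1 : 0 ≤ x.1) (hx2 : 0 ≤ x.2) (hx : x ≠ 0) :
    ((Ralloc K1 K2 x).1 = r1 ∧ (Ralloc K1 K2 x).2 = r2) ↔ x.2 = r2 / r1 * min x.1 K1 := by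
  have hratio : 0 < r2 / r1 := div_pos hr2 hr1
  have hle : r2 / r1 * min x.1 K1 ≤ r2 / r1 * K1 :=
    mul_le_mul_of_nonneg_left (min_le_right _ _) hratio.le
  constructor
  · rintro ⟨h1, h2⟩
    have hx1' : x.1 ≠ 0 := fun h => hr1.ne (by simpa [Ralloc, h] using h1)
    have hx2' : x.2 ≠ 0 := fun h => hr2.ne (by simpa [Ralloc, h] using h2)
    have ha : 0 < min x.1 K1 := lt_min (hx1.lt_of_ne' hx1') hK1
    have hb : 0 < min x.2 K2 := lt_min (hx2.lt_of_ne' hx2') hK2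
    simp only [Ralloc, if_neg hx1', if_neg hx2'] at h1 h2
    have hab : min x.2 K2 = r2 / r1 * min x.1 K1 := by
      rw [← h1, ← h2]
      field_simp
    rcases min_choice x.2 K2 with h | h
    · rw [← hab, h]
    · linarith
  · intro h
    have hx1' : x.1 ≠ 0 := by
      intro h0
      rw [h0, min_eq_left hK1.le, mul_zero] at h
      exact hx (Prod.ext h0 h)
    have ha : 0 < min x.1 K1 := lt_min (hx1.lt_of_ne' hx1') hK1
    have hx2' : x.2 ≠ 0 := h ▸ (mul_pos hratio ha).ne'
    have hb : min x.2 K2 = r2 / r1 * min x.1 K1 := by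
      rw [min_eq_left (by linarith), h]
    simp only [Ralloc, if_neg hx1', if_neg hx2', hb]
    have hsum : min x.1 K1 + r2 / r1 * min x.1 K1 = min x.1 K1 / r1 := by
      field_simp
      exact hr
    rw [hsum]
    constructor <;> field_simp

/-- Characterization of the zeros of the drift field `Ψ`: they are exactly the
points of the invariant manifold, which all have second coordinate `< K₂`. -/
theorem drift_zeros_characterization
    (lam1 lam2 mu1 mu2 : ℝ)
    (hlam1 : 0 < lam1) (hlam2 : 0 < lam2) (hmu1 : 0 < mu1) (hmu2 : 0 < mu2)
    (p11 p12 p21 p22 : ℝ)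
    (hp11 : 0 ≤ p11) (hp12 : 0 ≤ p12) (hp21 : 0 ≤ p21) (hp22 : 0 ≤ p22)
    (hrow1 : p11 + p12 ≤ 1) (hrow2 : p21 + p22 ≤ 1)
    (hspec : Filter.Tendsto
      (fun k : ℕ => (Matrix.of ![![p11, p12], ![p21, p22]] : Matrix (Fin 2) (Fin 2) ℝ) ^ k)
      Filter.atTop (nhds 0))
    (gam1 gam2 : ℝ)
    (hgam1 : gam1 = lam1 + p11 * gam1 + p21 * gam2)
    (hgam2 : gam2 = lam2 + p12 * gam1 + p22 * gam2)
    (rho1 rho2 : ℝ) (hrho1 : rho1 = gam1 / mu1) (hrho2 : rho2 = gam2 / mu2)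
    (tau1 tau2 : ℝ)
    (htau1 : tau1 = 1 / mu1 + p11 * tau1 + p12 * tau2)
    (htau2 : tau2 = 1 / mu2 + p21 * tau1 + p22 * tau2)
    (hcrit : rho1 + rho2 = 1)
    (K1 K2 : ℝ) (hK1 : 0 < K1) (hK2 : 0 < K2)
    (hbot : rho1 / K1 > rho2 / K2)
    :
    (∀ x : ℝ × ℝ, 0 ≤ x.1 → 0 ≤ x.2 → x ≠ 0 →
      ((Psi lam1 lam2 mu1 mu2 p11 p12 p21 p22 K1 K2 x = 0 ↔
        (mu1 * (Ralloc K1 K2 x).1 = gam1 ∧ mu2 * (Ralloc K1 K2 x).2 = gam2)) ∧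
       (Psi lam1 lam2 mu1 mu2 p11 p12 p21 p22 K1 K2 x = 0 ↔
        x.2 = rho2 / rho1 * min x.1 K1))) ∧
    (∀ x : ℝ × ℝ, 0 ≤ x.1 → 0 ≤ x.2 → x.2 = rho2 / rho1 * min x.1 K1 →
      x.2 ≤ rho2 / rho1 * K1) ∧
    rho2 / rho1 * K1 < K2 := by
  have hnonneg : ∀ {a b : ℝ}, p11 * a + p21 * b ≤ a → p12 * a + p22 * b ≤ b → 0 ≤ a ∧ 0 ≤ b :=
    nonneg_of_vecMul_le_fin_two hp11 hp12 hp21 hp22 hspec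
  obtain ⟨hg1, hg2⟩ := hnonneg (a := gam1) (b := gam2) (by linarith) (by linarith)
  have hgam1_pos : 0 < gam1 := by
    rw [hgam1]
    positivity
  have hgam2_pos : 0 < gam2 := by
    rw [hgam2]
    positivity
  have hr1 : 0 < rho1 := hrho1 ▸ div_pos hgam1_pos hmu1
  have hr2 : 0 < rho2 := hrho2 ▸ div_pos hgam2_pos hmu2
  have hK : rho2 / rho1 * K1 < K2 := by
    rw [gt_iff_lt, div_lt_div_iff₀ hK2 hK1] at hbot
    rw [div_mul_eq_mul_div, div_lt_iff₀ hr1]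
    linarith
  refine ⟨fun x hx1 hx2 hx => ?_, fun x _ _ h => ?_, hK⟩
  · have hzero : Psi lam1 lam2 mu1 mu2 p11 p12 p21 p22 K1 K2 x = 0 ↔
        (mu1 * (Ralloc K1 K2 x).1 = gam1 ∧ mu2 * (Ralloc K1 K2 x).2 = gam2) := by
      simp only [Psi, Prod.ext_iff, Prod.fst_zero, Prod.snd_zero]
      generalize mu1 * (Ralloc K1 K2 x).1 = a
      generalize mu2 * (Ralloc K1 K2 x).2 = b
      constructor
      · rintro ⟨h1, h2⟩
        obtain ⟨ha, hb⟩ := hnonneg (a := a - gam1) (b := b - gam2) (by linarith) (by linarith)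
        obtain ⟨ha', hb'⟩ := hnonneg (a := gam1 - a) (b := gam2 - b) (by linarith) (by linarith)
        exact ⟨by linarith, by linarith⟩
      · rintro ⟨rfl, rfl⟩
        exact ⟨by linarith, by linarith⟩
    refine ⟨hzero, hzero.trans ?_⟩
    rw [← Ralloc_eq_iff hK1 hK2 hr1 hr2 hcrit hK hx1 hx2 hx, hrho1, hrho2,
      eq_div_iff hmu1.ne', eq_div_iff hmu2.ne', mul_comm mu1, mul_comm mu2]
  · rw [h]
    exact mul_le_mul_of_nonneg_left (min_le_right _ _) (div_pos hr2 hr1).le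
end

section
/- (Lipschitz continuity of the allocation function away from the origin) For every ε > 0, the service allocation function R is Lipschitz continuous on the set {q ∈ ℝ₊² : q₁ + q₂ ≥ ε}; consequently the drift field Ψ is Lipschitz continuous on this set as well. -/
/-- A proportion `a / (a + b)` of nonnegative numbers with total bounded below by `m`
varies by at most `d / m` when `a` and `b` each vary by at most `d`. -/
lemma abs_div_add_sub_div_add_le {a b a' b' m d : ℝ} (ha : 0 ≤ a) (hb : 0 ≤ b)
    (hm : 0 < m) (hs : m ≤ a + b) (hs' : m ≤ a' + b')
    (had : |a - a'| ≤ d) (hbd : |b - b'| ≤ d) :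
    |a / (a + b) - a' / (a' + b')| ≤ m⁻¹ * d := by
  have hs0 : 0 < a + b := hm.trans_le hs
  have hs0' : 0 < a' + b' := hm.trans_le hs'
  have hd : 0 ≤ d := (abs_nonneg _).trans had
  have hnum : |a * b' - a' * b| ≤ (a + b) * d := by
    calc |a * b' - a' * b| = |b * (a - a') - a * (b - b')| := by ring_nf
      _ ≤ |b * (a - a')| + |a * (b - b')| := abs_sub _ _
      _ = b * |a - a'| + a * |b - b'| := by
        rw [abs_mul, abs_mul, abs_of_nonneg ha, abs_of_nonneg hb]
      _ ≤ b * d + a * d := by gcongr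
      _ = (a + b) * d := by ring
  calc |a / (a + b) - a' / (a' + b')|
      = |a * b' - a' * b| / ((a + b) * (a' + b')) := by
        rw [div_sub_div _ _ hs0.ne' hs0'.ne', abs_div, abs_of_pos (mul_pos hs0 hs0')]
        ring_nf
    _ ≤ (a + b) * d / ((a + b) * (a' + b')) := by gcongr
    _ = d / (a' + b') := mul_div_mul_left _ _ hs0.ne'
    _ ≤ d / m := by gcongr
    _ = m⁻¹ * d := div_eq_inv_mul _ _

/-- For positive capacities the case distinction in `Ralloc` is redundant. -/
lemma Ralloc_eq_div {K1 K2 : ℝ} (hK1 : 0 < K1) (hK2 : 0 < K2) (q : ℝ × ℝ) :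
    Ralloc K1 K2 q =
      (min q.1 K1 / (min q.1 K1 + min q.2 K2), min q.2 K2 / (min q.2 K2 + min q.1 K1)) := by
  ext
  · by_cases h : q.1 = 0 <;> simp [Ralloc, h, hK1.le]
  · by_cases h : q.2 = 0 <;> simp [Ralloc, h, hK2.le, add_comm]

/-- Away from the origin, the total truncated queue length is bounded below. -/
lemma min_le_min_add_min {K1 ε x y : ℝ} (hK1 : 0 < K1) (K2 : ℝ)
    (hx : 0 ≤ x) (hy : 0 ≤ y) (h : ε ≤ x + y) :
    min ε (min K1 K2) ≤ min x K1 + min y K2 := by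
  grind

lemma Ralloc_lipschitzOnWith {K1 K2 ε : ℝ} (hK1 : 0 < K1) (hK2 : 0 < K2) (hε : 0 < ε) :
    LipschitzOnWith (Real.toNNReal (min ε (min K1 K2))⁻¹) (Ralloc K1 K2)
      {q : ℝ × ℝ | 0 ≤ q.1 ∧ 0 ≤ q.2 ∧ ε ≤ q.1 + q.2} := by
  have hm : 0 < min ε (min K1 K2) := lt_min hε (lt_min hK1 hK2)
  refine LipschitzOnWith.of_dist_le_mul fun q hq r hr => ?_
  obtain ⟨hq1, hq2, hqs⟩ := hq
  obtain ⟨hr1, hr2, hrs⟩ := hr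
  have hsq := min_le_min_add_min hK1 K2 hq1 hq2 hqs
  have hsr := min_le_min_add_min hK1 K2 hr1 hr2 hrs
  have h1 : |min q.1 K1 - min r.1 K1| ≤ dist q r :=
    (abs_min_sub_min_le_max _ _ _ _).trans <| by
      simp [Prod.dist_eq, Real.dist_eq]
  have h2 : |min q.2 K2 - min r.2 K2| ≤ dist q r :=
    (abs_min_sub_min_le_max _ _ _ _).trans <| by
      simp [Prod.dist_eq, Real.dist_eq]
  have hq1' : 0 ≤ min q.1 K1 := le_min hq1 hK1.le
  have hq2' : 0 ≤ min q.2 K2 := le_min hq2 hK2.le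
  rw [Real.coe_toNNReal _ (by positivity), Ralloc_eq_div hK1 hK2, Ralloc_eq_div hK1 hK2,
    Prod.dist_eq]
  refine max_le ?_ ?_
  · exact abs_div_add_sub_div_add_le hq1' hq2' hm hsq hsr h1 h2
  · exact abs_div_add_sub_div_add_le hq2' hq1' hm (by rwa [add_comm]) (by rwa [add_comm]) h2 h1

/-- The linear map `x ↦ (I − Pᵀ)(μ ∘ x)`. -/
noncomputable def driftLinear (mu1 mu2 p11 p12 p21 p22 : ℝ) : ℝ × ℝ →L[ℝ] ℝ × ℝ :=
  ((mu1 - p11 * mu1) • ContinuousLinearMap.fst ℝ ℝ ℝ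
    - (p21 * mu2) • ContinuousLinearMap.snd ℝ ℝ ℝ).prod
  ((mu2 - p22 * mu2) • ContinuousLinearMap.snd ℝ ℝ ℝ
    - (p12 * mu1) • ContinuousLinearMap.fst ℝ ℝ ℝ)

lemma Psi_eq_sub_driftLinear (lam1 lam2 mu1 mu2 p11 p12 p21 p22 K1 K2 : ℝ) (q : ℝ × ℝ) :
    Psi lam1 lam2 mu1 mu2 p11 p12 p21 p22 K1 K2 q =
      (lam1, lam2) - driftLinear mu1 mu2 p11 p12 p21 p22 (Ralloc K1 K2 q) := by
  ext <;> simp [Psi, driftLinear] <;> ring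

/-- Lipschitz continuity of the service allocation function `R`, hence of the drift
field `Ψ`, on the set `{q ∈ ℝ₊² : q₁ + q₂ ≥ ε}`, for every `ε > 0`. -/
theorem alloc_drift_lipschitz_away_from_origin
    (lam1 lam2 mu1 mu2 : ℝ)
    (hlam1 : 0 < lam1) (hlam2 : 0 < lam2) (hmu1 : 0 < mu1) (hmu2 : 0 < mu2)
    (p11 p12 p21 p22 : ℝ)
    (hp11 : 0 ≤ p11) (hp12 : 0 ≤ p12) (hp21 : 0 ≤ p21) (hp22 : 0 ≤ p22)
    (hrow1 : p11 + p12 ≤ 1) (hrow2 : p21 + p22 ≤ 1)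
    (hspec : Filter.Tendsto
      (fun k : ℕ => (Matrix.of ![![p11, p12], ![p21, p22]] : Matrix (Fin 2) (Fin 2) ℝ) ^ k)
      Filter.atTop (nhds 0))
    (K1 K2 : ℝ) (hK1 : 0 < K1) (hK2 : 0 < K2)
    :
    ∀ ε > (0 : ℝ),
      (∃ C : NNReal, LipschitzOnWith C (Ralloc K1 K2)
        {q : ℝ × ℝ | 0 ≤ q.1 ∧ 0 ≤ q.2 ∧ ε ≤ q.1 + q.2}) ∧
      (∃ C' : NNReal, LipschitzOnWith C'
        (Psi lam1 lam2 mu1 mu2 p11 p12 p21 p22 K1 K2)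
        {q : ℝ × ℝ | 0 ≤ q.1 ∧ 0 ≤ q.2 ∧ ε ≤ q.1 + q.2}) := by
  intro ε hε
  have hR := Ralloc_lipschitzOnWith hK1 hK2 hε
  obtain ⟨C, hC⟩ : ∃ C, LipschitzOnWith C
      (driftLinear mu1 mu2 p11 p12 p21 p22 ∘ Ralloc K1 K2)
      {q : ℝ × ℝ | 0 ≤ q.1 ∧ 0 ≤ q.2 ∧ ε ≤ q.1 + q.2} :=
    ⟨_, (driftLinear mu1 mu2 p11 p12 p21 p22).lipschitz.comp_lipschitzOnWith hR⟩
  refine ⟨⟨_, hR⟩, C, LipschitzOnWith.of_dist_le_mul fun q hq r hr => ?_⟩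
  rw [Psi_eq_sub_driftLinear, Psi_eq_sub_driftLinear, dist_sub_left]
  exact hC.dist_le_mul q hq r hr
end

section
/- (Relations between the coefficients of Ξ) Under critical loading the following identities hold: τ₁λ₁ + τ₂λ₂ = 1; ξ₁₂ > 0 and ξ₂₁ > 0; ξ₂₂ = −(ρ₁/ρ₂)ξ₂₁ < 0; ξ₁₁ = −(ρ₂/ρ₁)ξ₁₂ < 0; ξ₁₂ = −(τ₂/τ₁)ξ₂₂; and ξ₂₁ = −(τ₁/τ₂)ξ₁₁. -/
/-- If `A` is entrywise nonnegative and its powers tend to `0`, then `A *ᵥ x ≤ x` forces `0 ≤ x`. -/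
theorem Matrix.nonneg_of_mulVec_le_self {n : Type*} [Fintype n] [DecidableEq n]
    {A : Matrix n n ℝ} (hA : ∀ i j, 0 ≤ A i j)
    (hlim : Filter.Tendsto (fun k : ℕ => A ^ k) Filter.atTop (nhds 0))
    {x : n → ℝ} (hx : A.mulVec x ≤ x) : 0 ≤ x := by
  have hpow : ∀ k : ℕ, (A ^ k).mulVec x ≤ x := by
    intro k
    induction k with
    | zero => simp
    | succ k ih =>
      rw [pow_succ', ← Matrix.mulVec_mulVec]
      refine le_trans (fun i => ?_) hx
      exact Finset.sum_le_sum fun j _ => mul_le_mul_of_nonneg_left (ih j) (hA i j)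
  have hcont : Continuous fun B : Matrix n n ℝ => B.mulVec x :=
    continuous_id.matrix_mulVec continuous_const
  have hzero : Filter.Tendsto (fun k : ℕ => (A ^ k).mulVec x) Filter.atTop (nhds 0) := by
    simpa [Function.comp_def] using (hcont.tendsto 0).comp hlim
  exact le_of_tendsto' hzero hpow

/-- A solution of `x = c + A x` with `c > 0` is positive when `A` is a nonnegative `2 × 2` matrix
whose powers tend to `0`. -/
theorem pos_of_eq_add_nonneg_mul {a b c d u v x y : ℝ}
    (ha : 0 ≤ a) (hb : 0 ≤ b) (hc : 0 ≤ c) (hd : 0 ≤ d)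
    (hlim : Filter.Tendsto (fun k : ℕ => (Matrix.of ![![a, b], ![c, d]] :
      Matrix (Fin 2) (Fin 2) ℝ) ^ k) Filter.atTop (nhds 0))
    (hu : 0 < u) (hv : 0 < v) (hx : x = u + a * x + b * y) (hy : y = v + c * x + d * y) :
    0 < x ∧ 0 < y := by
  have h : 0 ≤ ![x, y] := by
    refine Matrix.nonneg_of_mulVec_le_self (fun i j => ?_) hlim (fun i => ?_)
    · fin_cases i <;> fin_cases j <;> simpa
    · fin_cases i <;> simp [Matrix.mulVec, dotProduct, Fin.sum_univ_two] <;> linarith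
  have hx0 : 0 ≤ x := h 0
  have hy0 : 0 ≤ y := h 1
  constructor
  · rw [hx]; positivity
  · rw [hy]; positivity


/-- Relations between the coefficients of the matrix `Ξ` under critical loading. -/
theorem Xi_coefficient_relations
    (lam1 lam2 mu1 mu2 : ℝ)
    (hlam1 : 0 < lam1) (hlam2 : 0 < lam2) (hmu1 : 0 < mu1) (hmu2 : 0 < mu2)
    (p11 p12 p21 p22 : ℝ)
    (hp11 : 0 ≤ p11) (hp12 : 0 ≤ p12) (hp21 : 0 ≤ p21) (hp22 : 0 ≤ p22)
    (hrow1 : p11 + p12 ≤ 1) (hrow2 : p21 + p22 ≤ 1)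
    (hspec : Filter.Tendsto
      (fun k : ℕ => (Matrix.of ![![p11, p12], ![p21, p22]] : Matrix (Fin 2) (Fin 2) ℝ) ^ k)
      Filter.atTop (nhds 0))
    (gam1 gam2 : ℝ)
    (hgam1 : gam1 = lam1 + p11 * gam1 + p21 * gam2)
    (hgam2 : gam2 = lam2 + p12 * gam1 + p22 * gam2)
    (rho1 rho2 : ℝ) (hrho1 : rho1 = gam1 / mu1) (hrho2 : rho2 = gam2 / mu2)
    (tau1 tau2 : ℝ)
    (htau1 : tau1 = 1 / mu1 + p11 * tau1 + p12 * tau2)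
    (htau2 : tau2 = 1 / mu2 + p21 * tau1 + p22 * tau2)
    (hcrit : rho1 + rho2 = 1)
    (xi11 xi12 xi21 xi22 : ℝ)
    (hxi11 : xi11 = lam1 + mu1 * p11 - mu1)
    (hxi12 : xi12 = lam1 + mu2 * p21)
    (hxi21 : xi21 = lam2 + mu1 * p12)
    (hxi22 : xi22 = lam2 + mu2 * p22 - mu2)
    :
    tau1 * lam1 + tau2 * lam2 = 1 ∧
    0 < xi12 ∧ 0 < xi21 ∧
    xi22 = -(rho1 / rho2) * xi21 ∧ xi22 < 0 ∧
    xi11 = -(rho2 / rho1) * xi12 ∧ xi11 < 0 ∧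
    xi12 = -(tau2 / tau1) * xi22 ∧
    xi21 = -(tau1 / tau2) * xi11 := by
  have hspecT : Filter.Tendsto (fun k : ℕ => (Matrix.of ![![p11, p21], ![p12, p22]] :
      Matrix (Fin 2) (Fin 2) ℝ) ^ k) Filter.atTop (nhds 0) := by
    have hT : (Matrix.of ![![p11, p21], ![p12, p22]] : Matrix (Fin 2) (Fin 2) ℝ) =
        (Matrix.of ![![p11, p12], ![p21, p22]]).transpose := by
      ext i j
      fin_cases i <;> fin_cases j <;> rfl
    have hcont : Continuous fun B : Matrix (Fin 2) (Fin 2) ℝ => B.transpose :=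
      continuous_id.matrix_transpose
    simpa [hT, Function.comp_def, Matrix.transpose_pow] using (hcont.tendsto 0).comp hspec
  obtain ⟨hg1, hg2⟩ :=
    pos_of_eq_add_nonneg_mul hp11 hp21 hp12 hp22 hspecT hlam1 hlam2 hgam1 hgam2
  obtain ⟨ht1, ht2⟩ := pos_of_eq_add_nonneg_mul hp11 hp12 hp21 hp22 hspec
    (one_div_pos.mpr hmu1) (one_div_pos.mpr hmu2) htau1 htau2
  have hr1 : 0 < rho1 := hrho1 ▸ div_pos hg1 hmu1
  have hr2 : 0 < rho2 := hrho2 ▸ div_pos hg2 hmu2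
  have hgr1 : gam1 = rho1 * mu1 := by rw [hrho1]; field_simp
  have hgr2 : gam2 = rho2 * mu2 := by rw [hrho2]; field_simp
  have hm1 : mu1 * (1 / mu1) = 1 := by field_simp
  have hm2 : mu2 * (1 / mu2) = 1 := by field_simp
  have hwork : tau1 * lam1 + tau2 * lam2 = 1 := by
    have hdual : tau1 * lam1 + tau2 * lam2 = gam1 * (1 / mu1) + gam2 * (1 / mu2) := by
      linear_combination (-tau1) * hgam1 - tau2 * hgam2 + gam1 * htau1 + gam2 * htau2
    linear_combination hdual + hcrit - hrho1 - hrho2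
  have hx12 : 0 < xi12 := by rw [hxi12]; positivity
  have hx21 : 0 < xi21 := by rw [hxi21]; positivity
  have hrow_2 : rho1 * xi21 + rho2 * xi22 = 0 := by
    rw [hgr1, hgr2] at hgam2
    rw [hxi21, hxi22]
    linear_combination lam2 * hcrit - hgam2
  have hrow_1 : rho1 * xi11 + rho2 * xi12 = 0 := by
    rw [hgr1, hgr2] at hgam1
    rw [hxi11, hxi12]
    linear_combination lam1 * hcrit - hgam1
  have hcol_2 : tau1 * xi12 + tau2 * xi22 = 0 := by
    rw [hxi12, hxi22]
    linear_combination hwork - mu2 * htau2 - hm2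
  have hcol_1 : tau1 * xi11 + tau2 * xi21 = 0 := by
    rw [hxi11, hxi21]
    linear_combination hwork - mu1 * htau1 - hm1
  have hx22 : xi22 = -(rho1 / rho2) * xi21 := by
    field_simp
    linear_combination hrow_2
  have hx11 : xi11 = -(rho2 / rho1) * xi12 := by
    field_simp
    linear_combination hrow_1
  refine ⟨hwork, hx12, hx21, hx22, ?_, hx11, ?_, ?_, ?_⟩
  · rw [hx22]
    exact mul_neg_of_neg_of_pos (neg_neg_of_pos (div_pos hr1 hr2)) hx21
  · rw [hx11]
    exact mul_neg_of_neg_of_pos (neg_neg_of_pos (div_pos hr2 hr1)) hx12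
  · field_simp
    linear_combination hcol_2
  · field_simp
    linear_combination hcol_1
end

section
/- (Spectral decomposition of Ξ) Under critical loading, the matrix Ξ has eigenvalues α₁ = 0 and α₂ = ξ₁₁ + ξ₂₂ < 0; the vector (1, ρ₂/ρ₁)ᵀ is an eigenvector of Ξ for the eigenvalue 0, and the vector (1, −τ₁/τ₂)ᵀ is an eigenvector of Ξ for the eigenvalue α₂. -/
/-- If the powers of an entrywise nonnegative matrix `A` tend to `0` and `b` is entrywise positive,
then every solution of `x = b + A x` is entrywise positive. -/
theorem pos_of_eq_add_mulVec {n : Type*} [Fintype n] [DecidableEq n] {A : Matrix n n ℝ}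
    (hA : ∀ i j, 0 ≤ A i j)
    (hlim : Filter.Tendsto (fun k : ℕ => A ^ k) Filter.atTop (nhds 0))
    {b x : n → ℝ} (hb : ∀ i, 0 < b i) (hx : x = b + A.mulVec x) (i : n) : 0 < x i := by
  have hpow (k : ℕ) : ∀ i j, 0 ≤ (A ^ k) i j := by
    induction k with
    | zero =>
      intro i j
      rw [pow_zero, Matrix.one_apply]
      split_ifs <;> norm_num
    | succ k ih =>
      intro i j
      rw [pow_succ, Matrix.mul_apply]
      exact Finset.sum_nonneg fun l _ => mul_nonneg (ih i l) (hA l j)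
  have hanti : Antitone fun k : ℕ => (A ^ k).mulVec x i := by
    refine antitone_nat_of_succ_le fun k => ?_
    have hstep : (A ^ k).mulVec x = (A ^ k).mulVec b + (A ^ (k + 1)).mulVec x := by
      conv_lhs => rw [hx]
      rw [Matrix.mulVec_add, Matrix.mulVec_mulVec, pow_succ]
    have hnonneg : 0 ≤ (A ^ k).mulVec b i :=
      Finset.sum_nonneg fun j _ => mul_nonneg (hpow k i j) (hb j).le
    have := congrFun hstep i
    rw [Pi.add_apply] at this
    linarith
  have hzero : Filter.Tendsto (fun k : ℕ => (A ^ k).mulVec x i) Filter.atTop (nhds 0) := by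
    have hcont : Continuous fun B : Matrix n n ℝ => B.mulVec x i :=
      (continuous_apply i).comp (continuous_id.matrix_mulVec continuous_const)
    simpa [Function.comp_def] using (hcont.tendsto 0).comp hlim
  have h1 : 0 ≤ A.mulVec x i := by simpa using hanti.le_of_tendsto hzero 1
  have h2 := congrFun hx i
  rw [Pi.add_apply] at h2
  linarith [hb i]

/-- Spectral decomposition of `Ξ`: eigenvalue `0` with eigenvector `(1, ρ₂/ρ₁)ᵀ` and
eigenvalue `α₂ = ξ₁₁ + ξ₂₂ < 0` with eigenvector `(1, −τ₁/τ₂)ᵀ`. -/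
theorem Xi_spectral_decomposition
    (lam1 lam2 mu1 mu2 : ℝ)
    (hlam1 : 0 < lam1) (hlam2 : 0 < lam2) (hmu1 : 0 < mu1) (hmu2 : 0 < mu2)
    (p11 p12 p21 p22 : ℝ)
    (hp11 : 0 ≤ p11) (hp12 : 0 ≤ p12) (hp21 : 0 ≤ p21) (hp22 : 0 ≤ p22)
    (hrow1 : p11 + p12 ≤ 1) (hrow2 : p21 + p22 ≤ 1)
    (hspec : Filter.Tendsto
      (fun k : ℕ => (Matrix.of ![![p11, p12], ![p21, p22]] : Matrix (Fin 2) (Fin 2) ℝ) ^ k)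
      Filter.atTop (nhds 0))
    (gam1 gam2 : ℝ)
    (hgam1 : gam1 = lam1 + p11 * gam1 + p21 * gam2)
    (hgam2 : gam2 = lam2 + p12 * gam1 + p22 * gam2)
    (rho1 rho2 : ℝ) (hrho1 : rho1 = gam1 / mu1) (hrho2 : rho2 = gam2 / mu2)
    (tau1 tau2 : ℝ)
    (htau1 : tau1 = 1 / mu1 + p11 * tau1 + p12 * tau2)
    (htau2 : tau2 = 1 / mu2 + p21 * tau1 + p22 * tau2)
    (hcrit : rho1 + rho2 = 1)
    (xi11 xi12 xi21 xi22 : ℝ)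
    (hxi11 : xi11 = lam1 + mu1 * p11 - mu1)
    (hxi12 : xi12 = lam1 + mu2 * p21)
    (hxi21 : xi21 = lam2 + mu1 * p12)
    (hxi22 : xi22 = lam2 + mu2 * p22 - mu2)
    (alpha2 : ℝ) (halpha2 : alpha2 = xi11 + xi22)
    :
    alpha2 < 0 ∧
    (xi11 * 1 + xi12 * (rho2 / rho1) = 0 ∧
     xi21 * 1 + xi22 * (rho2 / rho1) = 0) ∧
    (xi11 * 1 + xi12 * (-(tau1 / tau2)) = alpha2 * 1 ∧
     xi21 * 1 + xi22 * (-(tau1 / tau2)) = alpha2 * (-(tau1 / tau2))) := by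
  set P : Matrix (Fin 2) (Fin 2) ℝ := Matrix.of ![![p11, p12], ![p21, p22]] with hP
  have hP0 : ∀ i j, 0 ≤ P i j := by
    intro i j
    fin_cases i <;> fin_cases j <;> simpa [hP]
  have htau : ∀ i, 0 < ![tau1, tau2] i := by
    refine pos_of_eq_add_mulVec hP0 hspec (b := ![1 / mu1, 1 / mu2]) ?_ ?_
    · intro i
      fin_cases i <;> simpa
    · ext i
      fin_cases i
      · simpa [hP, Matrix.mulVec, dotProduct, Fin.sum_univ_two, add_assoc, mul_comm] using htau1
      · simpa [hP, Matrix.mulVec, dotProduct, Fin.sum_univ_two, add_assoc, mul_comm] using htau2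
  have hspecT : Filter.Tendsto (fun k : ℕ => P.transpose ^ k) Filter.atTop (nhds 0) := by
    have hcont : Continuous fun B : Matrix (Fin 2) (Fin 2) ℝ => B.transpose :=
      continuous_id.matrix_transpose
    simpa [Function.comp_def, Matrix.transpose_pow] using (hcont.tendsto 0).comp hspec
  have hgam : ∀ i, 0 < ![gam1, gam2] i := by
    refine pos_of_eq_add_mulVec (fun i j => hP0 j i) hspecT (b := ![lam1, lam2]) ?_ ?_
    · intro i
      fin_cases i <;> simpa
    · ext i
      fin_cases i
      · simpa [hP, Matrix.mulVec, dotProduct, Fin.sum_univ_two, add_assoc] using hgam1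
      · simpa [hP, Matrix.mulVec, dotProduct, Fin.sum_univ_two, add_assoc] using hgam2
  have ht2 : 0 < tau2 := htau 1
  have hr1 : 0 < rho1 := hrho1 ▸ div_pos (hgam 0) hmu1
  have hr2 : 0 < rho2 := hrho2 ▸ div_pos (hgam 1) hmu2
  have hg1 : gam1 = mu1 * rho1 := by rw [hrho1]; field_simp
  have hg2 : gam2 = mu2 * rho2 := by rw [hrho2]; field_simp
  have hm1 : mu1 * (1 / mu1) = 1 := by field_simp
  have hm2 : mu2 * (1 / mu2) = 1 := by field_simp
  have hright1 : xi11 * rho1 + xi12 * rho2 = 0 := by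
    rw [hg1, hg2] at hgam1
    rw [hxi11, hxi12]
    linear_combination lam1 * hcrit - hgam1
  have hright2 : xi21 * rho1 + xi22 * rho2 = 0 := by
    rw [hg1, hg2] at hgam2
    rw [hxi21, hxi22]
    linear_combination lam2 * hcrit - hgam2
  have hdual : tau1 * lam1 + tau2 * lam2 = 1 := by
    have hd : tau1 * lam1 + tau2 * lam2 = gam1 * (1 / mu1) + gam2 * (1 / mu2) := by
      linear_combination gam1 * htau1 + gam2 * htau2 - tau1 * hgam1 - tau2 * hgam2
    rw [hrho1, hrho2] at hcrit
    linear_combination hd + hcrit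
  have hleft1 : tau1 * xi11 + tau2 * xi21 = 0 := by
    rw [hxi11, hxi21]
    linear_combination hdual - mu1 * htau1 - hm1
  have hleft2 : tau1 * xi12 + tau2 * xi22 = 0 := by
    rw [hxi12, hxi22]
    linear_combination hdual - mu2 * htau2 - hm2
  have hxi12_pos : 0 < xi12 := by rw [hxi12]; positivity
  have hxi21_pos : 0 < xi21 := by rw [hxi21]; positivity
  have hxi11_neg : xi11 < 0 := by
    by_contra! h
    linarith [mul_nonneg h hr1.le, mul_pos hxi12_pos hr2]
  have hxi22_neg : xi22 < 0 := by
    by_contra! h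
    linarith [mul_nonneg h hr2.le, mul_pos hxi21_pos hr1]
  refine ⟨by linarith, ⟨?_, ?_⟩, ?_, ?_⟩
  · field_simp
    linear_combination hright1
  · field_simp
    linear_combination hright2
  · rw [halpha2]
    field_simp
    linear_combination -hleft2
  · rw [halpha2]
    field_simp
    linear_combination hleft1
end

section
/- (Conservation law for the time-changed ODE) Under critical loading, τᵀΞ = (0,0); consequently, for every solution y of the time-changed ODE and every t ≥ 0, τ₁y₁(t) + τ₂y₂(t) = τ₁y₁(0) + τ₂y₂(0). -/
/-- A solution of the time-changed ODE: a differentiable function `y : [0,∞) → ℝ₊²` with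
`y′(t) = Ξ·(min(y₁(t),K₁), min(y₂(t),K₂))ᵀ` for all `t ≥ 0`. -/
def IsTCSolution (xi11 xi12 xi21 xi22 K1 K2 : ℝ) (y : ℝ → ℝ × ℝ) : Prop :=
  ∀ t : ℝ, 0 ≤ t → 0 ≤ (y t).1 ∧ 0 ≤ (y t).2 ∧
    HasDerivWithinAt y
      (xi11 * min (y t).1 K1 + xi12 * min (y t).2 K2,
       xi21 * min (y t).1 K1 + xi22 * min (y t).2 K2) (Set.Ici 0) t

/-- Conservation law for the time-changed ODE: `τᵀΞ = 0`, hence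
`τ₁y₁(t) + τ₂y₂(t)` is constant along solutions. -/
theorem tc_ode_conservation
    (lam1 lam2 mu1 mu2 : ℝ)
    (hlam1 : 0 < lam1) (hlam2 : 0 < lam2) (hmu1 : 0 < mu1) (hmu2 : 0 < mu2)
    (p11 p12 p21 p22 : ℝ)
    (hp11 : 0 ≤ p11) (hp12 : 0 ≤ p12) (hp21 : 0 ≤ p21) (hp22 : 0 ≤ p22)
    (hrow1 : p11 + p12 ≤ 1) (hrow2 : p21 + p22 ≤ 1)
    (hspec : Filter.Tendsto
      (fun k : ℕ => (Matrix.of ![![p11, p12], ![p21, p22]] : Matrix (Fin 2) (Fin 2) ℝ) ^ k)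
      Filter.atTop (nhds 0))
    (gam1 gam2 : ℝ)
    (hgam1 : gam1 = lam1 + p11 * gam1 + p21 * gam2)
    (hgam2 : gam2 = lam2 + p12 * gam1 + p22 * gam2)
    (rho1 rho2 : ℝ) (hrho1 : rho1 = gam1 / mu1) (hrho2 : rho2 = gam2 / mu2)
    (tau1 tau2 : ℝ)
    (htau1 : tau1 = 1 / mu1 + p11 * tau1 + p12 * tau2)
    (htau2 : tau2 = 1 / mu2 + p21 * tau1 + p22 * tau2)
    (hcrit : rho1 + rho2 = 1)
    (K1 K2 : ℝ) (hK1 : 0 < K1) (hK2 : 0 < K2)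
    (xi11 xi12 xi21 xi22 : ℝ)
    (hxi11 : xi11 = lam1 + mu1 * p11 - mu1)
    (hxi12 : xi12 = lam1 + mu2 * p21)
    (hxi21 : xi21 = lam2 + mu1 * p12)
    (hxi22 : xi22 = lam2 + mu2 * p22 - mu2)
    :
    (tau1 * xi11 + tau2 * xi21 = 0 ∧ tau1 * xi12 + tau2 * xi22 = 0) ∧
    (∀ y : ℝ → ℝ × ℝ, IsTCSolution xi11 xi12 xi21 xi22 K1 K2 y →
      ∀ t : ℝ, 0 ≤ t →
        tau1 * (y t).1 + tau2 * (y t).2 = tau1 * (y 0).1 + tau2 * (y 0).2) := by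
  have hload : tau1 * lam1 + tau2 * lam2 = 1 := by
    rw [hrho1, hrho2] at hcrit
    linear_combination hcrit - tau1 * hgam1 - tau2 * hgam2 + gam1 * htau1 + gam2 * htau2
  have hservice1 : mu1 * (1 / mu1) = 1 := mul_one_div_cancel hmu1.ne'
  have hservice2 : mu2 * (1 / mu2) = 1 := mul_one_div_cancel hmu2.ne'
  have hcol1 : tau1 * xi11 + tau2 * xi21 = 0 := by
    rw [hxi11, hxi21]
    linear_combination hload - mu1 * htau1 - hservice1
  have hcol2 : tau1 * xi12 + tau2 * xi22 = 0 := by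
    rw [hxi12, hxi22]
    linear_combination hload - mu2 * htau2 - hservice2
  refine ⟨⟨hcol1, hcol2⟩, fun y hy t ht => ?_⟩
  have hderiv : ∀ s : ℝ, 0 ≤ s →
      HasDerivWithinAt (fun r => tau1 * (y r).1 + tau2 * (y r).2) 0 (Set.Ici 0) s := by
    intro s hs
    obtain ⟨-, -, hys⟩ := hy s hs
    have hfst := hasFDerivAt_fst.comp_hasDerivWithinAt (𝕜 := ℝ) s hys
    have hsnd := hasFDerivAt_snd.comp_hasDerivWithinAt (𝕜 := ℝ) s hys
    refine ((hfst.const_mul tau1).add (hsnd.const_mul tau2)).congr_deriv ?_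
    simp only [ContinuousLinearMap.coe_fst', ContinuousLinearMap.coe_snd']
    linear_combination min (y s).1 K1 * hcol1 + min (y s).2 K2 * hcol2
  exact constant_of_has_deriv_right_zero
    (fun s hs => (hderiv s hs.1).continuousWithinAt.mono Set.Icc_subset_Ici_self)
    (fun s hs => (hderiv s hs.1).mono (Set.Ici_subset_Ici.2 hs.1)) t ⟨ht, le_rfl⟩
end

section
/- (Time-change lemma) Let y : [0,∞) → ℝ₊² \ {0} be a solution of the time-changed ODE. Then there exists a unique differentiable function G : [0,∞) → [0,∞) with G(0) = 0 and G′(t) = 1/(min(y₁(G(t)),K₁) + min(y₂(G(t)),K₂)) for all t ≥ 0; this G is strictly increasing, satisfies G(t) ≥ t/(K₁+K₂) for all t ≥ 0 (hence G(t) → ∞ as t → ∞ and G is invertible); and the function Q̄ defined by Q̄(t) = y(G(t)) is a fluid model solution, i.e. Q̄′(t) = Ψ(Q̄(t)) for all t ≥ 0. -/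
/-- A function on `[0, ∞)` with vanishing derivative is constant. -/
theorem eq_of_hasDerivWithinAt_Ici_zero {f : ℝ → ℝ}
    (hf : ∀ t : ℝ, 0 ≤ t → HasDerivWithinAt f 0 (Set.Ici 0) t) {t : ℝ} (ht : 0 ≤ t) :
    f t = f 0 := by
  have h := (convex_Ici (0 : ℝ)).norm_image_sub_le_of_norm_hasDerivWithin_le
    (f := f) (f' := fun _ => 0) (C := 0) (x := 0) (y := t)
    (fun x hx => hf x hx) (by simp) Set.self_mem_Ici ht
  rw [zero_mul] at h
  exact sub_eq_zero.mp (norm_le_zero_iff.mp h)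

/-- A continuous function with values in `[δ, M]`, `δ > 0`, has a primitive which is an
order isomorphism of `ℝ` vanishing at `0` and growing at rate at most `M`. -/
theorem exists_orderIso_primitive {n : ℝ → ℝ} (hn : Continuous n) {δ M : ℝ} (hδ : 0 < δ)
    (hlow : ∀ t, δ ≤ n t) (hup : ∀ t, n t ≤ M) :
    ∃ T : ℝ ≃o ℝ, T 0 = 0 ∧ (∀ t, HasDerivAt T (n t) t) ∧ ∀ t, 0 ≤ t → T t ≤ M * t := by
  set F : ℝ → ℝ := fun s => ∫ u in (0 : ℝ)..s, n u with hF
  have hF0 : F 0 = 0 := by simp [hF]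
  have hd : ∀ t, HasDerivAt F (n t) t := fun t => hn.integral_hasStrictDerivAt 0 t |>.hasDerivAt
  have hlin : ∀ c t : ℝ, HasDerivAt (fun t => c * t) c t := fun c t => by
    simpa using (hasDerivAt_id t).const_mul c
  have hmono : StrictMono F := strictMono_of_deriv_pos fun t => by
    rw [(hd t).deriv]; exact hδ.trans_le (hlow t)
  have hcont : Continuous F := continuous_iff_continuousAt.mpr fun t => (hd t).continuousAt
  have hlowF : Monotone fun t => F t - δ * t :=
    monotone_of_deriv_nonneg (fun t => ((hd t).sub (hlin δ t)).differentiableAt) fun t => by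
      rw [((hd t).fun_sub (hlin δ t)).deriv]; linarith [hlow t]
  have hupF : Monotone fun t => M * t - F t :=
    monotone_of_deriv_nonneg (fun t => ((hlin M t).sub (hd t)).differentiableAt) fun t => by
      rw [((hlin M t).fun_sub (hd t)).deriv]; linarith [hup t]
  have htop : Filter.Tendsto F Filter.atTop Filter.atTop := by
    refine Filter.tendsto_atTop_mono' _ ?_ (Filter.tendsto_id.const_mul_atTop hδ)
    filter_upwards [Filter.eventually_ge_atTop 0] with t ht
    have := hlowF ht
    simp only [hF0, id] at this ⊢
    linarith
  have hbot : Filter.Tendsto F Filter.atBot Filter.atBot := by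
    refine Filter.tendsto_atBot_mono' _ ?_ (Filter.tendsto_id.const_mul_atBot hδ)
    filter_upwards [Filter.eventually_le_atBot 0] with t ht
    have := hlowF ht
    simp only [hF0, id] at this ⊢
    linarith
  refine ⟨hmono.orderIsoOfSurjective F (hcont.surjective htop hbot), hF0, hd, fun t ht => ?_⟩
  have := hupF ht
  simp only [hF0] at this
  change F t ≤ M * t
  linarith

/-- The expected total workloads `τ = β + P τ` are positive. -/
theorem workload_pos {p q b s t : ℝ} {p' q' b' : ℝ} (hb : 0 < b) (hb' : 0 < b')
    (hq : 0 ≤ q) (hp' : 0 ≤ p') (hpq : p + q ≤ 1)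
    (hpq' : p' + q' ≤ 1) (hs : s = b + p * s + q * t) (ht : t = b' + p' * s + q' * t) :
    0 < s ∧ 0 < t := by
  rcases le_total s t with h | h
  · have hs0 : 0 < s := by
      by_contra! hneg
      nlinarith [mul_le_mul_of_nonneg_left h hq]
    exact ⟨hs0, hs0.trans_le h⟩
  · have ht0 : 0 < t := by
      by_contra! hneg
      nlinarith [mul_le_mul_of_nonneg_left h hp']
    exact ⟨ht0.trans_le h, ht0⟩

/-- A linear lower bound on a nonnegative vector bounds its truncated mass from below. -/
theorem truncated_mass_lower_bound {a b c x z K L : ℝ} (ha : 0 < a) (hb : 0 < b)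
    (hx : 0 ≤ x) (hz : 0 ≤ z) (hK : 0 < K) (hL : 0 < L) (h : a * x + b * z = c) :
    min (min K L) (c / (a + b)) ≤ min x K + min z L := by
  have hx' : 0 ≤ min x K := le_min hx hK.le
  have hz' : 0 ≤ min z L := le_min hz hL.le
  have h1 : min (min K L) (c / (a + b)) ≤ K := (min_le_left _ _).trans (min_le_left _ _)
  have h2 : min (min K L) (c / (a + b)) ≤ L := (min_le_left _ _).trans (min_le_right _ _)
  rcases le_total K x with hxK | hxK
  · rw [min_eq_right hxK]; linarith
  rcases le_total L z with hzL | hzL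
  · rw [min_eq_right hzL]; linarith
  rw [min_eq_left hxK, min_eq_left hzL]
  refine (min_le_right _ _).trans ?_
  rw [div_le_iff₀ (by positivity)]
  nlinarith [mul_nonneg ha.le hz, mul_nonneg hb.le hx]

/-- Time-change lemma: every solution `y` of the time-changed ODE avoiding the origin gives
rise, via a unique time change `G`, to a fluid model solution `Q̄(t) = y(G(t))`. -/
theorem time_change_lemma
    (lam1 lam2 mu1 mu2 : ℝ)
    (hlam1 : 0 < lam1) (hlam2 : 0 < lam2) (hmu1 : 0 < mu1) (hmu2 : 0 < mu2)
    (p11 p12 p21 p22 : ℝ)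
    (hp11 : 0 ≤ p11) (hp12 : 0 ≤ p12) (hp21 : 0 ≤ p21) (hp22 : 0 ≤ p22)
    (hrow1 : p11 + p12 ≤ 1) (hrow2 : p21 + p22 ≤ 1)
    (hspec : Filter.Tendsto
      (fun k : ℕ => (Matrix.of ![![p11, p12], ![p21, p22]] : Matrix (Fin 2) (Fin 2) ℝ) ^ k)
      Filter.atTop (nhds 0))
    (gam1 gam2 : ℝ)
    (hgam1 : gam1 = lam1 + p11 * gam1 + p21 * gam2)
    (hgam2 : gam2 = lam2 + p12 * gam1 + p22 * gam2)
    (rho1 rho2 : ℝ) (hrho1 : rho1 = gam1 / mu1) (hrho2 : rho2 = gam2 / mu2)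
    (tau1 tau2 : ℝ)
    (htau1 : tau1 = 1 / mu1 + p11 * tau1 + p12 * tau2)
    (htau2 : tau2 = 1 / mu2 + p21 * tau1 + p22 * tau2)
    (hcrit : rho1 + rho2 = 1)
    (K1 K2 : ℝ) (hK1 : 0 < K1) (hK2 : 0 < K2)
    (hbot : rho1 / K1 > rho2 / K2)
    (xi11 xi12 xi21 xi22 : ℝ)
    (hxi11 : xi11 = lam1 + mu1 * p11 - mu1)
    (hxi12 : xi12 = lam1 + mu2 * p21)
    (hxi21 : xi21 = lam2 + mu1 * p12)
    (hxi22 : xi22 = lam2 + mu2 * p22 - mu2)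
    (y : ℝ → ℝ × ℝ) (hy : IsTCSolution xi11 xi12 xi21 xi22 K1 K2 y)
    (hyne : ∀ t : ℝ, 0 ≤ t → y t ≠ 0) :
    ∃ G : ℝ → ℝ,
      (G 0 = 0 ∧
        (∀ t : ℝ, 0 ≤ t → 0 ≤ G t ∧
          HasDerivWithinAt G
            (1 / (min (y (G t)).1 K1 + min (y (G t)).2 K2)) (Set.Ici 0) t)) ∧
      StrictMonoOn G (Set.Ici 0) ∧
      (∀ t : ℝ, 0 ≤ t → t / (K1 + K2) ≤ G t) ∧
      Filter.Tendsto G Filter.atTop Filter.atTop ∧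
      Set.BijOn G (Set.Ici 0) (Set.Ici 0) ∧
      IsFluidSolution lam1 lam2 mu1 mu2 p11 p12 p21 p22 K1 K2 (fun t => y (G t)) ∧
      (∀ G' : ℝ → ℝ,
        G' 0 = 0 →
        (∀ t : ℝ, 0 ≤ t → 0 ≤ G' t ∧
          HasDerivWithinAt G'
            (1 / (min (y (G' t)).1 K1 + min (y (G' t)).2 K2)) (Set.Ici 0) t) →
        ∀ t : ℝ, 0 ≤ t → G' t = G t) := by
  obtain ⟨htau1p, htau2p⟩ := workload_pos (one_div_pos.mpr hmu1) (one_div_pos.mpr hmu2)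
    hp12 hp21 hrow1 hrow2 htau1 htau2
  have hload : tau1 * lam1 + tau2 * lam2 = 1 := by
    rw [← hcrit, hrho1, hrho2, div_eq_mul_one_div gam1, div_eq_mul_one_div gam2]
    linear_combination gam1 * htau1 + gam2 * htau2 - tau1 * hgam1 - tau2 * hgam2
  have hwork1 : mu1 * tau1 = 1 + mu1 * p11 * tau1 + mu1 * p12 * tau2 := by
    have : mu1 * (1 / mu1) = 1 := by field_simp
    linear_combination mu1 * htau1 + this
  have hwork2 : mu2 * tau2 = 1 + mu2 * p21 * tau1 + mu2 * p22 * tau2 := by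
    have : mu2 * (1 / mu2) = 1 := by field_simp
    linear_combination mu2 * htau2 + this
  have hcons : ∀ t : ℝ, 0 ≤ t →
      tau1 * (y t).1 + tau2 * (y t).2 = tau1 * (y 0).1 + tau2 * (y 0).2 := by
    intro t ht
    refine eq_of_hasDerivWithinAt_Ici_zero (f := fun t => tau1 * (y t).1 + tau2 * (y t).2)
      (fun s hs => ?_) ht
    obtain ⟨-, -, hd⟩ := hy s hs
    have hd1 := hd.hasFDerivWithinAt.fst.hasDerivWithinAt
    have hd2 := hd.hasFDerivWithinAt.snd.hasDerivWithinAt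
    simp only [ContinuousLinearMap.comp_apply, ContinuousLinearMap.toSpanSingleton_apply_one,
      ContinuousLinearMap.coe_fst', ContinuousLinearMap.coe_snd'] at hd1 hd2
    refine ((hd1.const_mul tau1).add (hd2.const_mul tau2)).congr_deriv ?_
    rw [hxi11, hxi12, hxi21, hxi22]
    linear_combination (min (y s).1 K1 + min (y s).2 K2) * hload
      - min (y s).1 K1 * hwork1 - min (y s).2 K2 * hwork2
  set c := tau1 * (y 0).1 + tau2 * (y 0).2 with hc
  have hcpos : 0 < c := by
    obtain ⟨h1, h2, -⟩ := hy 0 le_rfl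
    have hne := hyne 0 le_rfl
    rcases h1.lt_or_eq with h | h
    · positivity
    rcases h2.lt_or_eq with h' | h'
    · positivity
    exact absurd (Prod.ext h.symm h'.symm) hne
  have hδ : 0 < min (min K1 K2) (c / (tau1 + tau2)) := by positivity
  have hycont : Continuous fun t : ℝ => y (max t 0) := by
    have h : ContinuousOn y (Set.Ici 0) := fun t ht => (hy t ht).2.2.continuousWithinAt
    exact h.comp_continuous (by fun_prop) fun t => le_max_right t 0
  obtain ⟨T, hT0, hTd, hTup⟩ := exists_orderIso_primitive
    (n := fun t => min (y (max t 0)).1 K1 + min (y (max t 0)).2 K2)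
    ((hycont.fst.min continuous_const).add (hycont.snd.min continuous_const)) hδ
    (fun t => truncated_mass_lower_bound htau1p htau2p (hy _ (le_max_right t 0)).1
      (hy _ (le_max_right t 0)).2.1 hK1 hK2 (hcons _ (le_max_right t 0)))
    (fun t => add_le_add (min_le_right _ _) (min_le_right _ _))
  have hn : ∀ t : ℝ, 0 ≤ t → 0 < min (y t).1 K1 + min (y t).2 K2 := fun t ht =>
    hδ.trans_le (truncated_mass_lower_bound htau1p htau2p (hy t ht).1 (hy t ht).2.1 hK1 hK2
      (hcons t ht))
  have hTd' : ∀ t : ℝ, 0 ≤ t → HasDerivAt T (min (y t).1 K1 + min (y t).2 K2) t :=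
    fun t ht => by simpa only [max_eq_left ht] using hTd t
  have hG0 : T.symm 0 = 0 := by rw [OrderIso.symm_apply_eq, hT0]
  have hGnn : ∀ t : ℝ, 0 ≤ t → 0 ≤ T.symm t := fun t ht => by
    rw [← hG0]; exact T.symm.monotone ht
  have hGd : ∀ t : ℝ, 0 ≤ t → HasDerivAt T.symm
      (1 / (min (y (T.symm t)).1 K1 + min (y (T.symm t)).2 K2)) t := fun t ht => by
    rw [one_div]
    exact HasDerivAt.of_local_left_inverse T.symm.continuous.continuousAt
      (hTd' _ (hGnn t ht)) (hn _ (hGnn t ht)).ne'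
      (Filter.Eventually.of_forall T.apply_symm_apply)
  refine ⟨T.symm, ⟨hG0, fun t ht => ⟨hGnn t ht, (hGd t ht).hasDerivWithinAt⟩⟩,
    T.symm.strictMono.strictMonoOn _, fun t ht => ?_, T.symm.tendsto_atTop,
    ⟨hGnn, T.symm.injective.injOn, fun s hs => ⟨T s, ?_, T.symm_apply_apply s⟩⟩,
    fun t ht => ?_, fun G' hG'0 hG' t ht => ?_⟩
  · rw [div_le_iff₀ (by positivity), mul_comm]
    simpa using hTup _ (hGnn t ht)
  · rw [Set.mem_Ici, ← hT0]; exact T.monotone hs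
  · obtain ⟨h1, h2, hd⟩ := hy _ (hGnn t ht)
    refine ⟨h1, h2, hyne _ (hGnn t ht), ?_⟩
    refine (HasDerivWithinAt.scomp t hd (hGd t ht).hasDerivWithinAt hGnn).congr_deriv ?_
    have hpos := (hn _ (hGnn t ht)).ne'
    have hR : Ralloc K1 K2 (y (T.symm t)) =
        (min (y (T.symm t)).1 K1 / (min (y (T.symm t)).1 K1 + min (y (T.symm t)).2 K2),
         min (y (T.symm t)).2 K2 / (min (y (T.symm t)).1 K1 + min (y (T.symm t)).2 K2)) := by
      unfold Ralloc
      congr 1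
      · split_ifs with h
        · simp [h, hK1.le]
        · rfl
      · split_ifs with h
        · simp [h, hK2.le]
        · rfl
    unfold Psi
    rw [hR, hxi11, hxi12, hxi21, hxi22]
    ext
    · simp only [Prod.smul_mk, smul_eq_mul]
      field_simp
      ring
    · simp only [Prod.smul_mk, smul_eq_mul]
      field_simp
      ring
  · rw [← OrderIso.symm_apply_apply T (G' t)]
    congr 1
    have h := eq_of_hasDerivWithinAt_Ici_zero (f := fun t => T (G' t) - t) (fun s hs => ?_) ht
    · simpa [hG'0, hT0, sub_eq_zero] using h
    · obtain ⟨hs0, hsd⟩ := hG' s hs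
      refine (((hTd' _ hs0).comp_hasDerivWithinAt s hsd).sub
        (hasDerivWithinAt_id s _)).congr_deriv ?_
      rw [mul_one_div_cancel (hn _ hs0).ne', sub_self]
end

section
/- (Explicit solution in region Π₃) Let y be a solution of the time-changed ODE, let w₀ = τ₁y₁(0) + τ₂y₂(0), and suppose y(s) ∈ Π₃ for all s ∈ [0,t]. Then y₂(t) = (y₂(0) − (ρ₂/ρ₁)K₁)·e^{ξ₂₂ t} + (ρ₂/ρ₁)K₁ and y₁(t) = −(τ₂/τ₁)(y₂(0) − (ρ₂/ρ₁)K₁)·e^{ξ₂₂ t} + (w₀ − w*)/τ₁ + K₁. -/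
/-- The determinant of `I - P` is positive when the rows of `P` are substochastic and the traffic
equations with positive exogenous rates are solvable. -/
theorem det_pos_of_traffic {lam1 lam2 p11 p12 p21 p22 gam1 gam2 : ℝ}
    (hlam1 : 0 < lam1) (hlam2 : 0 < lam2) (hp12 : 0 ≤ p12) (hp21 : 0 ≤ p21)
    (hrow1 : p11 + p12 ≤ 1) (hrow2 : p21 + p22 ≤ 1)
    (hgam1 : gam1 = lam1 + p11 * gam1 + p21 * gam2)
    (hgam2 : gam2 = lam2 + p12 * gam1 + p22 * gam2) :
    0 < (1 - p11) * (1 - p22) - p12 * p21 := by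
  have hnonneg : 0 ≤ (1 - p11) * (1 - p22) - p12 * p21 := by
    nlinarith [mul_nonneg (by linarith : 0 ≤ 1 - p11 - p12) (by linarith : 0 ≤ 1 - p22),
      mul_nonneg hp12 (by linarith : 0 ≤ 1 - p22 - p21)]
  refine lt_of_le_of_ne hnonneg fun h0 => ?_
  have h1 : lam1 * (1 - p22) + p21 * lam2 = 0 := by
    linear_combination (-(1 - p22)) * hgam1 - p21 * hgam2 - gam1 * h0
  have h2 : lam2 * (1 - p11) + p12 * lam1 = 0 := by
    linear_combination (-(1 - p11)) * hgam2 - p12 * hgam1 - gam2 * h0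
  have hp21' : p21 = 0 := by
    nlinarith [mul_nonneg hlam1.le (by linarith : 0 ≤ 1 - p22), mul_nonneg hp21 hlam2.le]
  have hp11' : p11 = 1 := by
    nlinarith [mul_nonneg hlam2.le (by linarith : 0 ≤ 1 - p11), mul_nonneg hp12 hlam1.le]
  subst hp21' hp11'
  linarith

/-- A coordinate solving `u' = a (u - c)` on `[0, t]` is given by the exponential formula. -/
theorem eq_exp_of_hasDerivWithinAt_affine {u : ℝ → ℝ} {a c t : ℝ} (ht : 0 ≤ t)
    (hu : ∀ s ∈ Set.Icc 0 t, HasDerivWithinAt u (a * (u s - c)) (Set.Ici 0) s) :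
    u t = (u 0 - c) * Real.exp (a * t) + c := by
  have hd : ∀ s ∈ Set.Icc 0 t,
      HasDerivWithinAt (fun r => (u r - c) * Real.exp (-(a * r))) 0 (Set.Ici 0) s := by
    intro s hs
    have hexp : HasDerivAt (fun r => Real.exp (-(a * r))) (Real.exp (-(a * s)) * -(a * 1)) s :=
      ((hasDerivAt_id s).const_mul a).neg.exp
    exact (((hu s hs).sub_const c).mul hexp.hasDerivWithinAt).congr_deriv (by ring)
  have hconst := constant_of_has_deriv_right_zero
    (fun s hs => (hd s hs).continuousWithinAt.mono Set.Icc_subset_Ici_self)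
    (fun s hs => (hd s (Set.Ico_subset_Icc_self hs)).mono (Set.Ici_subset_Ici.2 hs.1))
    t (Set.right_mem_Icc.2 ht)
  simp only [mul_zero, neg_zero, Real.exp_zero, mul_one] at hconst
  rw [← hconst, mul_assoc, ← Real.exp_add, neg_add_cancel, Real.exp_zero]
  ring

/-- Explicit solution of the time-changed ODE in region `Π₃`. -/
theorem tc_ode_solution_region3
    (lam1 lam2 mu1 mu2 : ℝ)
    (hlam1 : 0 < lam1) (hlam2 : 0 < lam2) (hmu1 : 0 < mu1) (hmu2 : 0 < mu2)
    (p11 p12 p21 p22 : ℝ)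
    (hp11 : 0 ≤ p11) (hp12 : 0 ≤ p12) (hp21 : 0 ≤ p21) (hp22 : 0 ≤ p22)
    (hrow1 : p11 + p12 ≤ 1) (hrow2 : p21 + p22 ≤ 1)
    (hspec : Filter.Tendsto
      (fun k : ℕ => (Matrix.of ![![p11, p12], ![p21, p22]] : Matrix (Fin 2) (Fin 2) ℝ) ^ k)
      Filter.atTop (nhds 0))
    (gam1 gam2 : ℝ)
    (hgam1 : gam1 = lam1 + p11 * gam1 + p21 * gam2)
    (hgam2 : gam2 = lam2 + p12 * gam1 + p22 * gam2)
    (rho1 rho2 : ℝ) (hrho1 : rho1 = gam1 / mu1) (hrho2 : rho2 = gam2 / mu2)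
    (tau1 tau2 : ℝ)
    (htau1 : tau1 = 1 / mu1 + p11 * tau1 + p12 * tau2)
    (htau2 : tau2 = 1 / mu2 + p21 * tau1 + p22 * tau2)
    (hcrit : rho1 + rho2 = 1)
    (K1 K2 : ℝ) (hK1 : 0 < K1) (hK2 : 0 < K2)
    (hbot : rho1 / K1 > rho2 / K2)
    (xi11 xi12 xi21 xi22 : ℝ)
    (hxi11 : xi11 = lam1 + mu1 * p11 - mu1)
    (hxi12 : xi12 = lam1 + mu2 * p21)
    (hxi21 : xi21 = lam2 + mu1 * p12)
    (hxi22 : xi22 = lam2 + mu2 * p22 - mu2)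
    (wstar : ℝ) (hwstar : wstar = tau1 * K1 + tau2 * (rho2 / rho1) * K1)
    (y : ℝ → ℝ × ℝ) (hy : IsTCSolution xi11 xi12 xi21 xi22 K1 K2 y)
    (w0 : ℝ) (hw0 : w0 = tau1 * (y 0).1 + tau2 * (y 0).2)
    (t : ℝ) (ht : 0 ≤ t)
    (hPi3 : ∀ s : ℝ, 0 ≤ s → s ≤ t → K1 ≤ (y s).1 ∧ (y s).2 ≤ K2) :
    (y t).2 = ((y 0).2 - rho2 / rho1 * K1) * Real.exp (xi22 * t) + rho2 / rho1 * K1 ∧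
    (y t).1 = -(tau2 / tau1) * ((y 0).2 - rho2 / rho1 * K1) * Real.exp (xi22 * t)
      + (w0 - wstar) / tau1 + K1 := by
  have hD := det_pos_of_traffic hlam1 hlam2 hp12 hp21 hrow1 hrow2 hgam1 hgam2
  have hp22' : 0 < 1 - p22 := by
    refine lt_of_le_of_ne (by linarith) fun h => ?_
    rw [← h] at hD
    nlinarith [mul_nonneg hp12 hp21]
  have hgam1_pos : 0 < gam1 := by
    refine pos_of_mul_pos_right (a := (1 - p11) * (1 - p22) - p12 * p21) ?_ hD.le
    have h : ((1 - p11) * (1 - p22) - p12 * p21) * gam1 = lam1 * (1 - p22) + p21 * lam2 := by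
      linear_combination (1 - p22) * hgam1 + p21 * hgam2
    rw [h]
    positivity
  have htau1_pos : 0 < tau1 := by
    refine pos_of_mul_pos_right (a := (1 - p11) * (1 - p22) - p12 * p21) ?_ hD.le
    have h : ((1 - p11) * (1 - p22) - p12 * p21) * tau1
        = 1 / mu1 * (1 - p22) + p12 * (1 / mu2) := by
      linear_combination (1 - p22) * htau1 + p12 * htau2
    rw [h]
    positivity
  have hrho1_pos : 0 < rho1 := hrho1 ▸ div_pos hgam1_pos hmu1
  have hg1 : gam1 = mu1 * rho1 := by rw [hrho1]; field_simp
  have hg2 : gam2 = mu2 * rho2 := by rw [hrho2]; field_simp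
  have hkernel : xi21 * rho1 + xi22 * rho2 = 0 := by
    rw [hg1, hg2] at hgam2
    rw [hxi21, hxi22]
    linear_combination lam2 * hcrit - hgam2
  have hload : tau1 * lam1 + tau2 * lam2 = 1 := by
    have h : tau1 * lam1 + tau2 * lam2 = 1 / mu1 * gam1 + 1 / mu2 * gam2 := by
      linear_combination gam1 * htau1 + gam2 * htau2 - tau1 * hgam1 - tau2 * hgam2
    rw [hrho1, hrho2] at hcrit
    linear_combination h + hcrit
  have hm1 : mu1 * (1 / mu1) = 1 := by field_simp
  have hm2 : mu2 * (1 / mu2) = 1 := by field_simp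
  have hcol1 : tau1 * xi11 + tau2 * xi21 = 0 := by
    rw [hxi11, hxi21]
    linear_combination hload - mu1 * htau1 - hm1
  have hcol2 : tau1 * xi12 + tau2 * xi22 = 0 := by
    rw [hxi12, hxi22]
    linear_combination hload - mu2 * htau2 - hm2
  have hc : xi21 * K1 = -(xi22 * (rho2 / rho1 * K1)) := by
    have h : xi21 = -(xi22 * rho2) / rho1 := by
      rw [eq_div_iff hrho1_pos.ne']
      linear_combination hkernel
    rw [h]
    ring
  have hderiv1 : ∀ s, 0 ≤ s → HasDerivWithinAt (fun r => (y r).1)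
      (xi11 * min (y s).1 K1 + xi12 * min (y s).2 K2) (Set.Ici 0) s := fun s hs =>
    (hy s hs).2.2.hasFDerivWithinAt.fst.hasDerivWithinAt.congr_deriv (by simp)
  have hderiv2 : ∀ s, 0 ≤ s → HasDerivWithinAt (fun r => (y r).2)
      (xi21 * min (y s).1 K1 + xi22 * min (y s).2 K2) (Set.Ici 0) s := fun s hs =>
    (hy s hs).2.2.hasFDerivWithinAt.snd.hasDerivWithinAt.congr_deriv (by simp)
  have h2 : (y t).2 = ((y 0).2 - rho2 / rho1 * K1) * Real.exp (xi22 * t) + rho2 / rho1 * K1 := by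
    refine eq_exp_of_hasDerivWithinAt_affine (u := fun s => (y s).2) ht fun s hs => ?_
    obtain ⟨hs1, hs2⟩ := hPi3 s hs.1 hs.2
    refine (hderiv2 s hs.1).congr_deriv ?_
    simp only [min_eq_right hs1, min_eq_left hs2]
    linear_combination hc
  have hwork : tau1 * (y t).1 + tau2 * (y t).2 = w0 := by
    have h := eq_exp_of_hasDerivWithinAt_affine
      (u := fun s => tau1 * (y s).1 + tau2 * (y s).2) (a := 0) (c := 0) ht fun s hs => by
        refine (((hderiv1 s hs.1).const_mul tau1).add
          ((hderiv2 s hs.1).const_mul tau2)).congr_deriv ?_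
        linear_combination min (y s).1 K1 * hcol1 + min (y s).2 K2 * hcol2
    simpa [hw0] using h
  refine ⟨h2, ?_⟩
  rw [hwstar]
  rw [h2] at hwork
  have h1 : (y t).1 = (w0 - tau2 * (((y 0).2 - rho2 / rho1 * K1) * Real.exp (xi22 * t)
      + rho2 / rho1 * K1)) / tau1 := by
    rw [eq_div_iff htau1_pos.ne']
    linear_combination hwork
  rw [h1]
  field_simp
  ring
end

section
/- (Explicit solution in region Π₄) Let y be a solution of the time-changed ODE, let w₀ = τ₁y₁(0) + τ₂y₂(0), and suppose y(s) ∈ Π₄ for all s ∈ [0,t]. Set c₂ = (w₀/w*)K₁ and c′ = −(y₂(0) − (ρ₂/ρ₁)y₁(0))·τ₂ρ₁/(τ₁ρ₁ + τ₂ρ₂). Then y₁(t) = c₂ + c′·e^{α₂ t} and y₂(t) = (ρ₂/ρ₁)c₂ − (τ₁/τ₂)c′·e^{α₂ t}. -/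
/-- A function whose right derivative on `[0, t)` is `a` times itself is an exponential there. -/
theorem eq_mul_exp_of_hasDerivWithinAt_Ici {f : ℝ → ℝ} {a t : ℝ} (ht : 0 ≤ t)
    (hf : ∀ s ∈ Set.Icc 0 t, HasDerivWithinAt f (a * f s) (Set.Ici 0) s) :
    f t = f 0 * Real.exp (a * t) := by
  have hexp : ∀ s : ℝ, HasDerivAt (fun s => Real.exp (-(a * s)))
      (Real.exp (-(a * s)) * -(a * 1)) s :=
    fun s => (((hasDerivAt_id s).const_mul a).neg).exp
  have hg : ∀ s ∈ Set.Icc 0 t,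
      HasDerivWithinAt (fun s => f s * Real.exp (-(a * s))) 0 (Set.Ici 0) s := by
    intro s hs
    refine ((hf s hs).mul (hexp s).hasDerivWithinAt).congr_deriv ?_
    ring
  have hconst := constant_of_has_deriv_right_zero (a := 0) (b := t)
    (fun s hs => ((hg s hs).continuousWithinAt).mono Set.Icc_subset_Ici_self)
    (fun s hs => (hg s ⟨hs.1, hs.2.le⟩).mono (Set.Ici_subset_Ici.2 hs.1))
    t ⟨ht, le_rfl⟩
  simp only [mul_zero, neg_zero, Real.exp_zero, mul_one] at hconst
  rw [← hconst, mul_assoc, ← Real.exp_add]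
  simp

/-- Explicit solution of the time-changed ODE in region `Π₄`. -/
theorem tc_ode_solution_region4
    (lam1 lam2 mu1 mu2 : ℝ)
    (hlam1 : 0 < lam1) (hlam2 : 0 < lam2) (hmu1 : 0 < mu1) (hmu2 : 0 < mu2)
    (p11 p12 p21 p22 : ℝ)
    (hp11 : 0 ≤ p11) (hp12 : 0 ≤ p12) (hp21 : 0 ≤ p21) (hp22 : 0 ≤ p22)
    (hrow1 : p11 + p12 ≤ 1) (hrow2 : p21 + p22 ≤ 1)
    (hspec : Filter.Tendsto
      (fun k : ℕ => (Matrix.of ![![p11, p12], ![p21, p22]] : Matrix (Fin 2) (Fin 2) ℝ) ^ k)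
      Filter.atTop (nhds 0))
    (gam1 gam2 : ℝ)
    (hgam1 : gam1 = lam1 + p11 * gam1 + p21 * gam2)
    (hgam2 : gam2 = lam2 + p12 * gam1 + p22 * gam2)
    (rho1 rho2 : ℝ) (hrho1 : rho1 = gam1 / mu1) (hrho2 : rho2 = gam2 / mu2)
    (tau1 tau2 : ℝ)
    (htau1 : tau1 = 1 / mu1 + p11 * tau1 + p12 * tau2)
    (htau2 : tau2 = 1 / mu2 + p21 * tau1 + p22 * tau2)
    (hcrit : rho1 + rho2 = 1)
    (K1 K2 : ℝ) (hK1 : 0 < K1) (hK2 : 0 < K2)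
    (hbot : rho1 / K1 > rho2 / K2)
    (xi11 xi12 xi21 xi22 : ℝ)
    (hxi11 : xi11 = lam1 + mu1 * p11 - mu1)
    (hxi12 : xi12 = lam1 + mu2 * p21)
    (hxi21 : xi21 = lam2 + mu1 * p12)
    (hxi22 : xi22 = lam2 + mu2 * p22 - mu2)
    (alpha2 : ℝ) (halpha2 : alpha2 = xi11 + xi22)
    (wstar : ℝ) (hwstar : wstar = tau1 * K1 + tau2 * (rho2 / rho1) * K1)
    (y : ℝ → ℝ × ℝ) (hy : IsTCSolution xi11 xi12 xi21 xi22 K1 K2 y)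
    (w0 : ℝ) (hw0 : w0 = tau1 * (y 0).1 + tau2 * (y 0).2)
    (t : ℝ) (ht : 0 ≤ t)
    (hPi4 : ∀ s : ℝ, 0 ≤ s → s ≤ t → (y s).1 ≤ K1 ∧ (y s).2 ≤ K2) :
    (y t).1 = w0 / wstar * K1
      + (-(((y 0).2 - rho2 / rho1 * (y 0).1) * (tau2 * rho1 / (tau1 * rho1 + tau2 * rho2))))
        * Real.exp (alpha2 * t) ∧
    (y t).2 = rho2 / rho1 * (w0 / wstar * K1)
      - tau1 / tau2 *
        (-(((y 0).2 - rho2 / rho1 * (y 0).1) * (tau2 * rho1 / (tau1 * rho1 + tau2 * rho2))))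
        * Real.exp (alpha2 * t) := by
  have hrho1_pos : 0 < rho1 := by
    by_contra! h
    have h2 : 0 < rho2 / K2 := div_pos (by linarith) hK2
    have h1 : rho1 / K1 ≤ 0 := div_nonpos_of_nonpos_of_nonneg h hK1.le
    linarith
  have hg1 : gam1 = mu1 * rho1 := by rw [hrho1]; field_simp
  have hg2 : gam2 = mu2 * rho2 := by rw [hrho2]; field_simp
  have hgam1_pos : 0 < gam1 := hg1 ▸ mul_pos hmu1 hrho1_pos
  have hgam2_pos : 0 < gam2 := by
    have h : 0 < (1 - p22) * gam2 := by linarith only [mul_nonneg hp12 hgam1_pos.le, hgam2, hlam2]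
    exact pos_of_mul_pos_right h (by linarith only [hrow2, hp21])
  have hrho2_pos : 0 < rho2 := hrho2 ▸ div_pos hgam2_pos hmu2
  have hb1 : mu1 * (1 / mu1) = 1 := by field_simp
  have hb2 : mu2 * (1 / mu2) = 1 := by field_simp
  have hbeta1 : 0 < 1 / mu1 := by positivity
  have hbeta2 : 0 < 1 / mu2 := by positivity
  generalize 1 / mu1 = b1 at *
  generalize 1 / mu2 = b2 at *
  have htl : tau1 * lam1 + tau2 * lam2 = 1 := by
    linear_combination (-tau1) * hgam1 - tau2 * hgam2 + gam1 * htau1 + gam2 * htau2 + hcrit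
      + b1 * hg1 + b2 * hg2 + rho1 * hb1 + rho2 * hb2
  have htau2_of : 0 < tau1 → 0 < tau2 := fun h => by
    have h' : 0 < (1 - p22) * tau2 := by linarith only [mul_nonneg hp21 h.le, htau2, hbeta2]
    exact pos_of_mul_pos_right h' (by linarith only [hrow1, hrow2, hp12, hp21])
  have htau1_of : 0 < tau2 → 0 < tau1 := fun h => by
    have h' : 0 < (1 - p11) * tau1 := by linarith only [mul_nonneg hp12 h.le, htau1, hbeta1]
    exact pos_of_mul_pos_right h' (by linarith only [hrow1, hrow2, hp12, hp21])
  have htau1_pos : 0 < tau1 := by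
    by_contra! h
    exact h.not_gt (htau1_of (by
      by_contra! h2
      linarith only [htl, mul_nonneg (neg_nonneg.2 h) hlam1.le,
        mul_nonneg (neg_nonneg.2 h2) hlam2.le]))
  have htau2_pos := htau2_of htau1_pos
  have hleft1 : tau1 * xi11 + tau2 * xi21 = 0 := by
    rw [hxi11, hxi21]
    linear_combination htl - mu1 * htau1 - hb1
  have hleft2 : tau1 * xi12 + tau2 * xi22 = 0 := by
    rw [hxi12, hxi22]
    linear_combination htl - mu2 * htau2 - hb2
  have hright1 : xi11 * rho1 + xi12 * rho2 = 0 := by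
    rw [hxi11, hxi12]
    linear_combination lam1 * hcrit - hgam1 + (1 - p11) * hg1 - p21 * hg2
  have hright2 : xi21 * rho1 + xi22 * rho2 = 0 := by
    rw [hxi21, hxi22]
    linear_combination lam2 * hcrit - hgam2 + (1 - p22) * hg2 - p12 * hg1
  obtain ⟨r, hr⟩ : ∃ r, r = rho2 / rho1 := ⟨_, rfl⟩
  have hrr : rho2 = r * rho1 := by rw [hr]; field_simp
  have hr_pos : 0 < r := hr ▸ div_pos hrho2_pos hrho1_pos
  have hx11 : xi11 = -r * xi12 := by
    apply mul_right_cancel₀ hrho1_pos.ne'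
    linear_combination hright1 - xi12 * hrr
  have hx21 : xi21 = -r * xi22 := by
    apply mul_right_cancel₀ hrho1_pos.ne'
    linear_combination hright2 - xi22 * hrr
  have hder : ∀ s ∈ Set.Icc 0 t,
      HasDerivWithinAt (fun s => (y s).1) (xi11 * (y s).1 + xi12 * (y s).2) (Set.Ici 0) s ∧
      HasDerivWithinAt (fun s => (y s).2) (xi21 * (y s).1 + xi22 * (y s).2) (Set.Ici 0) s := by
    intro s hs
    have h := (hy s hs.1).2.2
    obtain ⟨h1, h2⟩ := hPi4 s hs.1 hs.2
    rw [min_eq_left h1, min_eq_left h2] at h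
    exact ⟨h.hasFDerivWithinAt.fst.hasDerivWithinAt.congr_deriv (by simp),
      h.hasFDerivWithinAt.snd.hasDerivWithinAt.congr_deriv (by simp)⟩
  have hw : tau1 * (y t).1 + tau2 * (y t).2 = w0 := by
    have h := eq_mul_exp_of_hasDerivWithinAt_Ici (a := 0)
      (f := fun s => tau1 * (y s).1 + tau2 * (y s).2) ht (fun s hs => by
        refine (((hder s hs).1.const_mul tau1).add ((hder s hs).2.const_mul tau2)).congr_deriv ?_
        linear_combination (y s).1 * hleft1 + (y s).2 * hleft2)
    simpa [hw0] using h
  have hv : (y t).2 - r * (y t).1 = ((y 0).2 - r * (y 0).1) * Real.exp (alpha2 * t) :=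
    eq_mul_exp_of_hasDerivWithinAt_Ici (f := fun s => (y s).2 - r * (y s).1) ht (fun s hs => by
      refine ((hder s hs).2.sub ((hder s hs).1.const_mul r)).congr_deriv ?_
      rw [halpha2]
      linear_combination (y s).1 * hx21 + (- (y s).2) * hx11)
  have hD : 0 < tau1 + tau2 * r := by positivity
  have hc : w0 / wstar * K1 = w0 / (tau1 + tau2 * r) := by
    have : wstar = (tau1 + tau2 * r) * K1 := by rw [hwstar, ← hr]; ring
    rw [this]; field_simp
  have hc' : tau2 * rho1 / (tau1 * rho1 + tau2 * rho2) = tau2 / (tau1 + tau2 * r) := by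
    have : tau1 * rho1 + tau2 * rho2 = (tau1 + tau2 * r) * rho1 := by rw [hrr]; ring
    rw [this]; field_simp
  rw [← hr, hc, hc']
  generalize Real.exp (alpha2 * t) = E at *
  constructor
  · field_simp
    linear_combination hw - tau2 * hv
  · field_simp
    linear_combination r * hw + tau1 * hv
end

section
/- (Strict decrease in regions Π₁ and Π₂) Let y be a solution of the time-changed ODE and suppose y(t) ∈ Π₁ ∪ Π₂, i.e. y₂(t) ≥ K₂. Then y₂′(t) ≤ −ε₁, where ε₁ = (τ₁/τ₂)·ξ₁₂·(K₂ − (ρ₂/ρ₁)K₁) > 0; in particular y₂ is strictly decreasing whenever it is at least K₂. -/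
open Filter Topology Matrix in
/-- If the powers of an entrywise nonnegative matrix `A` tend to zero, every vector `x` with
`A x ≤ x` is nonnegative. -/
theorem nonneg_of_mulVec_le_of_tendsto_pow {ι : Type*} [Fintype ι] [DecidableEq ι]
    {A : Matrix ι ι ℝ} (hA : ∀ i j, 0 ≤ A i j)
    (hlim : Tendsto (fun k : ℕ => A ^ k) atTop (𝓝 0)) {x : ι → ℝ} (hx : ∀ i, (A *ᵥ x) i ≤ x i)
    (i : ι) : 0 ≤ x i := by
  have hmono : ∀ k : ℕ, ∀ i, (A ^ k *ᵥ x) i ≤ x i := by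
    intro k
    induction k with
    | zero => simp
    | succ k ih =>
      intro i
      rw [pow_succ', ← mulVec_mulVec]
      exact (Finset.sum_le_sum fun j _ => mul_le_mul_of_nonneg_left (ih j) (hA i j)).trans (hx i)
  have hcont : Continuous fun B : Matrix ι ι ℝ => (B *ᵥ x) i :=
    (continuous_apply i).comp (continuous_id.matrix_mulVec continuous_const)
  have hzero : Tendsto (fun k : ℕ => (A ^ k *ᵥ x) i) atTop (𝓝 0) := by
    simpa [Function.comp_def] using (hcont.tendsto 0).comp hlim
  exact le_of_tendsto' hzero fun k => hmono k i

open Filter Topology in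
/-- A solution `x` of `x = b + A x` with `A` a nonnegative 2×2 matrix whose powers tend to zero
and `b` positive is positive. -/
theorem pos_of_eq_add_of_tendsto_pow {a11 a12 a21 a22 b1 b2 x1 x2 : ℝ}
    (h11 : 0 ≤ a11) (h12 : 0 ≤ a12) (h21 : 0 ≤ a21) (h22 : 0 ≤ a22)
    (hlim : Tendsto
      (fun k : ℕ => (Matrix.of ![![a11, a12], ![a21, a22]] : Matrix (Fin 2) (Fin 2) ℝ) ^ k)
      atTop (𝓝 0))
    (hb1 : 0 < b1) (hb2 : 0 < b2)
    (hx1 : x1 = b1 + a11 * x1 + a12 * x2) (hx2 : x2 = b2 + a21 * x1 + a22 * x2) :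
    0 < x1 ∧ 0 < x2 := by
  have hx := nonneg_of_mulVec_le_of_tendsto_pow (x := ![x1, x2])
    (by simp [Fin.forall_fin_two, h11, h12, h21, h22]) hlim (by
      simp only [Fin.forall_fin_two, Matrix.mulVec, dotProduct, Fin.sum_univ_two]
      simp
      constructor <;> linarith)
  have h1 : 0 ≤ x1 := hx 0
  have h2 : 0 ≤ x2 := hx 1
  constructor
  · rw [hx1]; positivity
  · rw [hx2]; positivity

/-- Strict decrease of `y₂` in regions `Π₁ ∪ Π₂` (i.e. where `y₂(t) ≥ K₂`). -/
theorem tc_ode_strict_decrease_regions12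
    (lam1 lam2 mu1 mu2 : ℝ)
    (hlam1 : 0 < lam1) (hlam2 : 0 < lam2) (hmu1 : 0 < mu1) (hmu2 : 0 < mu2)
    (p11 p12 p21 p22 : ℝ)
    (hp11 : 0 ≤ p11) (hp12 : 0 ≤ p12) (hp21 : 0 ≤ p21) (hp22 : 0 ≤ p22)
    (hrow1 : p11 + p12 ≤ 1) (hrow2 : p21 + p22 ≤ 1)
    (hspec : Filter.Tendsto
      (fun k : ℕ => (Matrix.of ![![p11, p12], ![p21, p22]] : Matrix (Fin 2) (Fin 2) ℝ) ^ k)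
      Filter.atTop (nhds 0))
    (gam1 gam2 : ℝ)
    (hgam1 : gam1 = lam1 + p11 * gam1 + p21 * gam2)
    (hgam2 : gam2 = lam2 + p12 * gam1 + p22 * gam2)
    (rho1 rho2 : ℝ) (hrho1 : rho1 = gam1 / mu1) (hrho2 : rho2 = gam2 / mu2)
    (tau1 tau2 : ℝ)
    (htau1 : tau1 = 1 / mu1 + p11 * tau1 + p12 * tau2)
    (htau2 : tau2 = 1 / mu2 + p21 * tau1 + p22 * tau2)
    (hcrit : rho1 + rho2 = 1)
    (K1 K2 : ℝ) (hK1 : 0 < K1) (hK2 : 0 < K2)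
    (hbot : rho1 / K1 > rho2 / K2)
    (xi11 xi12 xi21 xi22 : ℝ)
    (hxi11 : xi11 = lam1 + mu1 * p11 - mu1)
    (hxi12 : xi12 = lam1 + mu2 * p21)
    (hxi21 : xi21 = lam2 + mu1 * p12)
    (hxi22 : xi22 = lam2 + mu2 * p22 - mu2)
    (y : ℝ → ℝ × ℝ) (hy : IsTCSolution xi11 xi12 xi21 xi22 K1 K2 y)
    (t : ℝ) (ht : 0 ≤ t) (hPi12 : K2 ≤ (y t).2) :
    0 < tau1 / tau2 * xi12 * (K2 - rho2 / rho1 * K1) ∧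
    ∀ d : ℝ × ℝ, HasDerivWithinAt y d (Set.Ici 0) t →
      d.2 ≤ -(tau1 / tau2 * xi12 * (K2 - rho2 / rho1 * K1)) := by
  have hspecT : Filter.Tendsto
      (fun k : ℕ => (Matrix.of ![![p11, p21], ![p12, p22]] : Matrix (Fin 2) (Fin 2) ℝ) ^ k)
      Filter.atTop (nhds 0) := by
    have hT : (Matrix.of ![![p11, p21], ![p12, p22]] : Matrix (Fin 2) (Fin 2) ℝ) =
        (Matrix.of ![![p11, p12], ![p21, p22]] : Matrix (Fin 2) (Fin 2) ℝ).transpose := by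
      ext i j; fin_cases i <;> fin_cases j <;> rfl
    simp only [hT, ← Matrix.transpose_pow]
    simpa [Function.comp_def] using ((continuous_id.matrix_transpose).tendsto
      (0 : Matrix (Fin 2) (Fin 2) ℝ)).comp hspec
  obtain ⟨hg1, hg2⟩ :=
    pos_of_eq_add_of_tendsto_pow hp11 hp21 hp12 hp22 hspecT hlam1 hlam2 hgam1 hgam2
  obtain ⟨ht1, ht2⟩ := pos_of_eq_add_of_tendsto_pow hp11 hp12 hp21 hp22 hspec
    (one_div_pos.mpr hmu1) (one_div_pos.mpr hmu2) htau1 htau2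
  have hr1 : 0 < rho1 := hrho1 ▸ div_pos hg1 hmu1
  have hx12 : 0 < xi12 := by rw [hxi12]; positivity
  have hgr1 : gam1 = mu1 * rho1 := by rw [hrho1]; field_simp
  have hgr2 : gam2 = mu2 * rho2 := by rw [hrho2]; field_simp
  -- `ρ` spans the right kernel of `Ξ`, and `τ` the left kernel.
  have hker : xi11 * rho1 + xi12 * rho2 = 0 := by
    rw [hgr1, hgr2] at hgam1
    rw [hxi11, hxi12]
    linear_combination lam1 * hcrit - hgam1
  have hmt1 : mu1 * (tau1 - p11 * tau1 - p12 * tau2) = 1 := by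
    rw [show tau1 - p11 * tau1 - p12 * tau2 = 1 / mu1 by linarith]; field_simp
  have hmt2 : mu2 * (tau2 - p21 * tau1 - p22 * tau2) = 1 := by
    rw [show tau2 - p21 * tau1 - p22 * tau2 = 1 / mu2 by linarith]; field_simp
  have hlt : tau1 * lam1 + tau2 * lam2 = 1 := by
    rw [hgr1, hgr2] at hgam1 hgam2
    linear_combination hcrit - tau1 * hgam1 - tau2 * hgam2 + rho1 * hmt1 + rho2 * hmt2
  have hleft1 : tau1 * xi11 + tau2 * xi21 = 0 := by
    rw [hxi11, hxi21]; linear_combination hlt - hmt1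
  have hleft2 : tau1 * xi12 + tau2 * xi22 = 0 := by
    rw [hxi12, hxi22]; linear_combination hlt - hmt2
  have hr2 : 0 < rho2 := hrho2 ▸ div_pos hg2 hmu2
  have hgap : 0 < K2 - rho2 / rho1 * K1 := by
    rw [gt_iff_lt, div_lt_div_iff₀ hK2 hK1] at hbot
    rw [sub_pos, div_mul_eq_mul_div, div_lt_iff₀ hr1]
    linarith
  refine ⟨by positivity, fun d hd => ?_⟩
  have hd2 : d.2 = xi21 * min (y t).1 K1 + xi22 * K2 := by
    rw [(uniqueDiffOn_Ici (0 : ℝ) t ht).eq_deriv _ hd (hy t ht).2.2, min_eq_right hPi12]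
  have hx11 : xi11 = -(rho2 / rho1 * xi12) := by field_simp; linarith
  have hx21 : xi21 = tau1 / tau2 * xi12 * (rho2 / rho1) := by
    have : xi21 = -(tau1 / tau2 * xi11) := by field_simp; linarith
    rw [this, hx11]; ring
  have hx22 : xi22 = -(tau1 / tau2 * xi12) := by field_simp; linarith
  have hle : xi21 * min (y t).1 K1 ≤ xi21 * K1 :=
    mul_le_mul_of_nonneg_left (min_le_right _ _) (by rw [hx21]; positivity)
  calc d.2 ≤ xi21 * K1 + xi22 * K2 := by linarith
    _ = _ := by rw [hx21, hx22]; ring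
end

section
/- (Sign of the derivative in region Π₃) Let y be a solution of the time-changed ODE, let w₀ = τ₁y₁(0) + τ₂y₂(0), and suppose y(s) ∈ Π₃ for all s ∈ [0,t]. Then y₂′(t) > 0 if y₁(0) > (w₀ − w*)/τ₁ + K₁; y₂′(t) < 0 if y₁(0) < (w₀ − w*)/τ₁ + K₁; and y₂′(t) = 0 if y₁(0) = (w₀ − w*)/τ₁ + K₁. -/
/-- Solutions of `x = b + P x` with positive input `b` and substochastic `P` are positive. -/
lemma pos_of_eq_add_substochastic_mul {b1 b2 p11 p12 p21 p22 x1 x2 : ℝ}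
    (hb1 : 0 < b1) (hb2 : 0 < b2)
    (hp12 : 0 ≤ p12) (hp21 : 0 ≤ p21)
    (hrow1 : p11 + p12 ≤ 1) (hrow2 : p21 + p22 ≤ 1)
    (h1 : x1 = b1 + p11 * x1 + p12 * x2) (h2 : x2 = b2 + p21 * x1 + p22 * x2) :
    0 < x1 ∧ 0 < x2 := by
  rcases le_total x1 x2 with h | h
  · have : 0 < x1 := by
      by_contra! hx
      nlinarith [mul_nonneg hp12 (sub_nonneg.2 h)]
    exact ⟨this, this.trans_le h⟩
  · have : 0 < x2 := by
      by_contra! hx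
      nlinarith [mul_nonneg hp21 (sub_nonneg.2 h)]
    exact ⟨this.trans_le h, this⟩

/-- The traffic equations `x = b + Pᵀ x` with positive input and substochastic `P`
have only positive solutions. -/
lemma pos_of_eq_add_transpose_substochastic_mul {b1 b2 p11 p12 p21 p22 x1 x2 : ℝ}
    (hb1 : 0 < b1) (hb2 : 0 < b2)
    (hp12 : 0 ≤ p12) (hp21 : 0 ≤ p21)
    (hrow1 : p11 + p12 ≤ 1) (hrow2 : p21 + p22 ≤ 1)
    (h1 : x1 = b1 + p11 * x1 + p21 * x2) (h2 : x2 = b2 + p12 * x1 + p22 * x2) :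
    0 < x1 ∧ 0 < x2 := by
  rcases le_or_gt x1 0 with hx1 | hx1 <;> rcases le_or_gt x2 0 with hx2 | hx2
  · nlinarith
  · nlinarith [mul_nonneg hp21 hx2.le]
  · nlinarith [mul_nonneg hp12 hx1.le]
  · exact ⟨hx1, hx2⟩

/-- Along a solution of the scalar affine equation `u′ = a + c u` on `[0,t]`, the right-hand side
evolves as a pure exponential. -/
lemma affine_ode_rhs_eq {u : ℝ → ℝ} {a c t : ℝ} (ht : 0 ≤ t)
    (hu : ∀ s ∈ Set.Icc 0 t, HasDerivWithinAt u (a + c * u s) (Set.Ici 0) s) :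
    a + c * u t = (a + c * u 0) * Real.exp (c * t) := by
  have hd : ∀ s ∈ Set.Icc 0 t,
      HasDerivWithinAt (fun s => (a + c * u s) * Real.exp (-(c * s))) 0 (Set.Ici 0) s := by
    intro s hs
    have he : HasDerivAt (fun s : ℝ => Real.exp (-(c * s))) (Real.exp (-(c * s)) * -(c * 1)) s :=
      (((hasDerivAt_id s).const_mul c).neg).exp
    exact ((((hu s hs).const_mul c).const_add a).mul he.hasDerivWithinAt).congr_deriv (by ring)
  have hconst := constant_of_has_deriv_right_zero
    (fun s hs => (hd s hs).continuousWithinAt.mono Set.Icc_subset_Ici_self)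
    (fun s hs => (hd s (Set.Ico_subset_Icc_self hs)).mono (Set.Ici_subset_Ici.2 hs.1))
    t (Set.right_mem_Icc.2 ht)
  simp only [mul_zero, neg_zero, Real.exp_zero, mul_one] at hconst
  rw [← hconst, mul_assoc, ← Real.exp_add, neg_add_cancel, Real.exp_zero, mul_one]

/-- Sign of the derivative of `y₂` in region `Π₃`. -/
theorem tc_ode_derivative_sign_region3
    (lam1 lam2 mu1 mu2 : ℝ)
    (hlam1 : 0 < lam1) (hlam2 : 0 < lam2) (hmu1 : 0 < mu1) (hmu2 : 0 < mu2)
    (p11 p12 p21 p22 : ℝ)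
    (hp11 : 0 ≤ p11) (hp12 : 0 ≤ p12) (hp21 : 0 ≤ p21) (hp22 : 0 ≤ p22)
    (hrow1 : p11 + p12 ≤ 1) (hrow2 : p21 + p22 ≤ 1)
    (hspec : Filter.Tendsto
      (fun k : ℕ => (Matrix.of ![![p11, p12], ![p21, p22]] : Matrix (Fin 2) (Fin 2) ℝ) ^ k)
      Filter.atTop (nhds 0))
    (gam1 gam2 : ℝ)
    (hgam1 : gam1 = lam1 + p11 * gam1 + p21 * gam2)
    (hgam2 : gam2 = lam2 + p12 * gam1 + p22 * gam2)
    (rho1 rho2 : ℝ) (hrho1 : rho1 = gam1 / mu1) (hrho2 : rho2 = gam2 / mu2)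
    (tau1 tau2 : ℝ)
    (htau1 : tau1 = 1 / mu1 + p11 * tau1 + p12 * tau2)
    (htau2 : tau2 = 1 / mu2 + p21 * tau1 + p22 * tau2)
    (hcrit : rho1 + rho2 = 1)
    (K1 K2 : ℝ) (hK1 : 0 < K1) (hK2 : 0 < K2)
    (hbot : rho1 / K1 > rho2 / K2)
    (xi11 xi12 xi21 xi22 : ℝ)
    (hxi11 : xi11 = lam1 + mu1 * p11 - mu1)
    (hxi12 : xi12 = lam1 + mu2 * p21)
    (hxi21 : xi21 = lam2 + mu1 * p12)
    (hxi22 : xi22 = lam2 + mu2 * p22 - mu2)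
    (wstar : ℝ) (hwstar : wstar = tau1 * K1 + tau2 * (rho2 / rho1) * K1)
    (y : ℝ → ℝ × ℝ) (hy : IsTCSolution xi11 xi12 xi21 xi22 K1 K2 y)
    (w0 : ℝ) (hw0 : w0 = tau1 * (y 0).1 + tau2 * (y 0).2)
    (t : ℝ) (ht : 0 ≤ t)
    (hPi3 : ∀ s : ℝ, 0 ≤ s → s ≤ t → K1 ≤ (y s).1 ∧ (y s).2 ≤ K2) :
    ∀ d : ℝ × ℝ, HasDerivWithinAt y d (Set.Ici 0) t →
      (((w0 - wstar) / tau1 + K1 < (y 0).1 → 0 < d.2) ∧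
       ((y 0).1 < (w0 - wstar) / tau1 + K1 → d.2 < 0) ∧
       ((y 0).1 = (w0 - wstar) / tau1 + K1 → d.2 = 0)) := by
  intro d hd
  obtain ⟨htau1_pos, htau2_pos⟩ := pos_of_eq_add_substochastic_mul (one_div_pos.2 hmu1)
    (one_div_pos.2 hmu2) hp12 hp21 hrow1 hrow2 htau1 htau2
  obtain ⟨hgam1_pos, hgam2_pos⟩ := pos_of_eq_add_transpose_substochastic_mul hlam1 hlam2
    hp12 hp21 hrow1 hrow2 hgam1 hgam2
  have hrho1_pos : 0 < rho1 := hrho1 ▸ div_pos hgam1_pos hmu1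
  have hrho2_pos : 0 < rho2 := hrho2 ▸ div_pos hgam2_pos hmu2
  have hgr1 : gam1 = mu1 * rho1 := by rw [hrho1]; field_simp
  have hgr2 : gam2 = mu2 * rho2 := by rw [hrho2]; field_simp
  have hbalance : xi21 * rho1 + xi22 * rho2 = 0 := by
    rw [hgr1, hgr2] at hgam2
    rw [hxi21, hxi22]
    linear_combination lam2 * hcrit - hgam2
  have hxi21_pos : 0 < xi21 := by rw [hxi21]; positivity
  have hxi22_neg : xi22 < 0 := by
    by_contra! h
    nlinarith [mul_pos hxi21_pos hrho1_pos, mul_nonneg h hrho2_pos.le]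
  have hode : ∀ s ∈ Set.Icc 0 t, HasDerivWithinAt (fun s => (y s).2)
      (xi21 * K1 + xi22 * (y s).2) (Set.Ici 0) s := by
    intro s hs
    have h := (hy s hs.1).2.2
    rw [min_eq_right (hPi3 s hs.1 hs.2).1, min_eq_left (hPi3 s hs.1 hs.2).2] at h
    exact h.snd
  have hd2 : d.2 = (xi21 * K1 + xi22 * (y 0).2) * Real.exp (xi22 * t) := by
    rw [← affine_ode_rhs_eq ht hode]
    exact (uniqueDiffOn_Ici (0 : ℝ) t ht).eq_deriv _ hd.snd (hode t ⟨ht, le_rfl⟩)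
  have hxi21_eq : xi21 = -xi22 * (rho2 / rho1) := by
    field_simp
    linarith
  have hrhs : xi21 * K1 + xi22 * (y 0).2 = -xi22 * (rho2 / rho1 * K1 - (y 0).2) := by
    rw [hxi21_eq]; ring
  have hgap : (y 0).1 - ((w0 - wstar) / tau1 + K1) =
      tau2 / tau1 * (rho2 / rho1 * K1 - (y 0).2) := by
    rw [hw0, hwstar]
    field_simp
    ring
  have hratio : 0 < tau2 / tau1 := div_pos htau2_pos htau1_pos
  have hexp := Real.exp_pos (xi22 * t)
  rw [hd2, hrhs]
  refine ⟨fun h => ?_, fun h => ?_, fun h => ?_⟩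
  · have hpos := pos_of_mul_pos_right (hgap ▸ sub_pos.2 h) hratio.le
    exact mul_pos (mul_pos (neg_pos.2 hxi22_neg) hpos) hexp
  · have hneg := neg_of_mul_neg_right (hgap ▸ sub_neg.2 h) hratio.le
    exact mul_neg_of_neg_of_pos (mul_neg_of_pos_of_neg (neg_pos.2 hxi22_neg) hneg) hexp
  · have hzero := (mul_eq_zero.1 (hgap ▸ sub_eq_zero.2 h)).resolve_left hratio.ne'
    rw [hzero, mul_zero, zero_mul]
end

section
/- (Sign of the derivative in region Π₄) Let y be a solution of the time-changed ODE, let w₀ = τ₁y₁(0) + τ₂y₂(0), and suppose y(s) ∈ Π₄ for all s ∈ [0,t]. Then y₂′(t) > 0 if y₁(0) > (w₀/w*)K₁; y₂′(t) < 0 if y₁(0) < (w₀/w*)K₁; and y₂′(t) = 0 if y₁(0) = (w₀/w*)K₁. -/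
/-- If the traffic equations `g = l + Pᵀ g` of a substochastic `2 × 2` matrix `P` are solvable for
some positive `l`, then `det (1 - P) > 0`. -/
theorem one_sub_det_pos_of_traffic_eq {l1 l2 p11 p12 p21 p22 g1 g2 : ℝ}
    (hl1 : 0 < l1) (hl2 : 0 < l2) (hp12 : 0 ≤ p12) (hp21 : 0 ≤ p21)
    (hrow1 : p11 + p12 ≤ 1) (hrow2 : p21 + p22 ≤ 1)
    (hg1 : g1 = l1 + p11 * g1 + p21 * g2) (hg2 : g2 = l2 + p12 * g1 + p22 * g2) :
    0 < (1 - p11) * (1 - p22) - p12 * p21 := by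
  have hD : 0 ≤ (1 - p11) * (1 - p22) - p12 * p21 := by
    nlinarith [mul_le_mul (show p12 ≤ 1 - p11 by linarith) (show p21 ≤ 1 - p22 by linarith)
      hp21 (by linarith)]
  refine lt_of_le_of_ne hD fun h0 => ?_
  have e : (1 - p11) * l2 + p12 * l1 = 0 := by
    linear_combination (-(1 - p11)) * hg2 - p12 * hg1 - g2 * h0
  have e' : (1 - p22) * l1 + p21 * l2 = 0 := by
    linear_combination (-(1 - p22)) * hg1 - p21 * hg2 - g1 * h0
  have h1 : 0 ≤ (1 - p11) * l2 := mul_nonneg (by linarith) hl2.le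
  have h2 : 0 ≤ p12 * l1 := mul_nonneg hp12 hl1.le
  have h3 : 0 ≤ (1 - p22) * l1 := mul_nonneg (by linarith) hl1.le
  have h4 : 0 ≤ p21 * l2 := mul_nonneg hp21 hl2.le
  have k1 : p12 = 0 := by
    have : p12 * l1 = 0 := by linarith
    simpa [hl1.ne'] using this
  have k2 : 1 - p22 = 0 := by
    have : (1 - p22) * l1 = 0 := by linarith
    simpa [hl1.ne'] using this
  have : l2 = 0 := by linear_combination -hg2 + g2 * k2 - g1 * k1
  exact hl2.ne' this

/-- For `A` of size two with nonnegative off-diagonal entries, diagonal entries at most one and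
`det (1 - A) > 0`, any solution of `x = b + A x` with positive `b` is positive. -/
theorem pos_of_eq_add_of_one_sub_det_pos {a11 a12 a21 a22 b1 b2 x1 x2 : ℝ}
    (hb1 : 0 < b1) (hb2 : 0 < b2) (h12 : 0 ≤ a12) (h21 : 0 ≤ a21)
    (h22 : a22 ≤ 1)
    (hD : 0 < (1 - a11) * (1 - a22) - a12 * a21)
    (hx1 : x1 = b1 + a11 * x1 + a12 * x2) (hx2 : x2 = b2 + a21 * x1 + a22 * x2) :
    0 < x1 ∧ 0 < x2 := by
  have hprod : 0 < (1 - a11) * (1 - a22) := by linarith [mul_nonneg h12 h21]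
  have q1 : 0 < 1 - a11 := pos_of_mul_pos_left hprod (by linarith)
  have q2 : 0 < 1 - a22 := pos_of_mul_pos_right hprod (by linarith)
  have e1 : ((1 - a11) * (1 - a22) - a12 * a21) * x1 = (1 - a22) * b1 + a12 * b2 := by
    linear_combination (1 - a22) * hx1 + a12 * hx2
  have e2 : ((1 - a11) * (1 - a22) - a12 * a21) * x2 = (1 - a11) * b2 + a21 * b1 := by
    linear_combination (1 - a11) * hx2 + a21 * hx1
  exact ⟨pos_of_mul_pos_right (e1 ▸ by positivity) hD.le,
    pos_of_mul_pos_right (e2 ▸ by positivity) hD.le⟩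

/-- A solution of the scalar linear equation `z' = -c z` on `[0, t]` is exponential. -/
theorem eq_mul_exp_of_hasDerivWithinAt {z : ℝ → ℝ} {c t : ℝ} (ht : 0 ≤ t)
    (hz : ∀ s ∈ Set.Icc 0 t, HasDerivWithinAt z (-c * z s) (Set.Ici 0) s) :
    z t = z 0 * Real.exp (-(c * t)) := by
  have hd : ∀ s ∈ Set.Icc 0 t,
      HasDerivWithinAt (fun s => z s * Real.exp (c * s)) 0 (Set.Ici 0) s := by
    intro s hs
    have he : HasDerivAt (fun s : ℝ => Real.exp (c * s)) (Real.exp (c * s) * (c * 1)) s :=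
      ((hasDerivAt_id s).const_mul c).exp
    refine ((hz s hs).mul he.hasDerivWithinAt).congr_deriv ?_
    ring
  have h := constant_of_has_deriv_right_zero
    (fun s hs => ((hd s hs).continuousWithinAt).mono Set.Icc_subset_Ici_self)
    (fun s hs => (hd s ⟨hs.1, hs.2.le⟩).mono (Set.Ici_subset_Ici.2 hs.1)) t ⟨ht, le_rfl⟩
  simp only [mul_zero, Real.exp_zero, mul_one] at h
  rw [← h, mul_assoc, ← Real.exp_add, add_neg_cancel, Real.exp_zero, mul_one]

/-- Sign of the derivative of `y₂` in region `Π₄`. -/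
theorem tc_ode_derivative_sign_region4
    (lam1 lam2 mu1 mu2 : ℝ)
    (hlam1 : 0 < lam1) (hlam2 : 0 < lam2) (hmu1 : 0 < mu1) (hmu2 : 0 < mu2)
    (p11 p12 p21 p22 : ℝ)
    (hp11 : 0 ≤ p11) (hp12 : 0 ≤ p12) (hp21 : 0 ≤ p21) (hp22 : 0 ≤ p22)
    (hrow1 : p11 + p12 ≤ 1) (hrow2 : p21 + p22 ≤ 1)
    (hspec : Filter.Tendsto
      (fun k : ℕ => (Matrix.of ![![p11, p12], ![p21, p22]] : Matrix (Fin 2) (Fin 2) ℝ) ^ k)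
      Filter.atTop (nhds 0))
    (gam1 gam2 : ℝ)
    (hgam1 : gam1 = lam1 + p11 * gam1 + p21 * gam2)
    (hgam2 : gam2 = lam2 + p12 * gam1 + p22 * gam2)
    (rho1 rho2 : ℝ) (hrho1 : rho1 = gam1 / mu1) (hrho2 : rho2 = gam2 / mu2)
    (tau1 tau2 : ℝ)
    (htau1 : tau1 = 1 / mu1 + p11 * tau1 + p12 * tau2)
    (htau2 : tau2 = 1 / mu2 + p21 * tau1 + p22 * tau2)
    (hcrit : rho1 + rho2 = 1)
    (K1 K2 : ℝ) (hK1 : 0 < K1) (hK2 : 0 < K2)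
    (hbot : rho1 / K1 > rho2 / K2)
    (xi11 xi12 xi21 xi22 : ℝ)
    (hxi11 : xi11 = lam1 + mu1 * p11 - mu1)
    (hxi12 : xi12 = lam1 + mu2 * p21)
    (hxi21 : xi21 = lam2 + mu1 * p12)
    (hxi22 : xi22 = lam2 + mu2 * p22 - mu2)
    (wstar : ℝ) (hwstar : wstar = tau1 * K1 + tau2 * (rho2 / rho1) * K1)
    (y : ℝ → ℝ × ℝ) (hy : IsTCSolution xi11 xi12 xi21 xi22 K1 K2 y)
    (w0 : ℝ) (hw0 : w0 = tau1 * (y 0).1 + tau2 * (y 0).2)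
    (t : ℝ) (ht : 0 ≤ t)
    (hPi4 : ∀ s : ℝ, 0 ≤ s → s ≤ t → (y s).1 ≤ K1 ∧ (y s).2 ≤ K2) :
    ∀ d : ℝ × ℝ, HasDerivWithinAt y d (Set.Ici 0) t →
      ((w0 / wstar * K1 < (y 0).1 → 0 < d.2) ∧
       ((y 0).1 < w0 / wstar * K1 → d.2 < 0) ∧
       ((y 0).1 = w0 / wstar * K1 → d.2 = 0)) := by
  intro d hd
  have hD := one_sub_det_pos_of_traffic_eq hlam1 hlam2 hp12 hp21 hrow1 hrow2 hgam1 hgam2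
  have h22 : p22 ≤ 1 := by linarith
  obtain ⟨hg1, hg2⟩ := pos_of_eq_add_of_one_sub_det_pos hlam1 hlam2 hp21 hp12 h22
    (by linarith) hgam1 hgam2
  obtain ⟨ht1, ht2⟩ := pos_of_eq_add_of_one_sub_det_pos (one_div_pos.2 hmu1) (one_div_pos.2 hmu2)
    hp12 hp21 h22 hD htau1 htau2
  have hr1 : 0 < rho1 := hrho1 ▸ div_pos hg1 hmu1
  have hr2 : 0 < rho2 := hrho2 ▸ div_pos hg2 hmu2
  have hG1 : mu1 * rho1 = gam1 := by rw [hrho1]; field_simp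
  have hG2 : mu2 * rho2 = gam2 := by rw [hrho2]; field_simp
  have hker1 : xi11 * rho1 + xi12 * rho2 = 0 := by
    rw [hxi11, hxi12]
    linear_combination lam1 * hcrit + (p11 - 1) * hG1 + p21 * hG2 - hgam1
  have hker2 : xi21 * rho1 + xi22 * rho2 = 0 := by
    rw [hxi21, hxi22]
    linear_combination lam2 * hcrit + p12 * hG1 + (p22 - 1) * hG2 - hgam2
  have hxi21pos : 0 < xi21 := by rw [hxi21]; positivity
  have hlin : ∀ s ∈ Set.Icc 0 t, HasDerivWithinAt y
      (xi11 * (y s).1 + xi12 * (y s).2, xi21 * (y s).1 + xi22 * (y s).2) (Set.Ici 0) s := by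
    intro s hs
    have h := (hy s hs.1).2.2
    rwa [min_eq_left (hPi4 s hs.1 hs.2).1, min_eq_left (hPi4 s hs.1 hs.2).2] at h
  have hz := eq_mul_exp_of_hasDerivWithinAt (z := fun s => rho2 * (y s).1 - rho1 * (y s).2)
    (c := xi12 * rho2 / rho1 + xi21 * rho1 / rho2) ht fun s hs => by
      have h1 := (hasFDerivAt_fst (𝕜 := ℝ) (p := y s)).comp_hasDerivWithinAt s (hlin s hs)
      have h2 := (hasFDerivAt_snd (𝕜 := ℝ) (p := y s)).comp_hasDerivWithinAt s (hlin s hs)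
      refine ((h1.const_mul rho2).sub (h2.const_mul rho1)).congr_deriv ?_
      have k1 : xi11 = -(xi12 * rho2 / rho1) := by field_simp; linarith
      have k2 : xi22 = -(xi21 * rho1 / rho2) := by field_simp; linarith
      simp only [ContinuousLinearMap.coe_fst', ContinuousLinearMap.coe_snd', k1, k2]
      field_simp
      ring
  set E := Real.exp (-((xi12 * rho2 / rho1 + xi21 * rho1 / rho2) * t)) with hE
  have hEpos : 0 < E := Real.exp_pos _
  have hd2 : d.2 = xi21 * (y t).1 + xi22 * (y t).2 := by
    rw [(uniqueDiffOn_Ici (0 : ℝ) t ht).eq_deriv _ hd (hlin t ⟨ht, le_rfl⟩)]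
  have hW : 0 < tau1 * rho1 + tau2 * rho2 := by positivity
  have hquot : (y 0).1 - w0 / wstar * K1
      = tau2 / (tau1 * rho1 + tau2 * rho2) * (rho2 * (y 0).1 - rho1 * (y 0).2) := by
    have hws : wstar = K1 * (tau1 * rho1 + tau2 * rho2) / rho1 := by
      rw [hwstar]; field_simp
    rw [hws, hw0]
    field_simp
    ring
  have hkey : d.2 = xi21 / rho2 * E * ((tau1 * rho1 + tau2 * rho2) / tau2) *
      ((y 0).1 - w0 / wstar * K1) := by
    have hd2z : d.2 = xi21 / rho2 * (rho2 * (y t).1 - rho1 * (y t).2) := by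
      rw [hd2]
      field_simp
      linear_combination (y t).2 * hker2
    rw [hd2z, hz, hquot]
    field_simp
  have hc : 0 < xi21 / rho2 * E * ((tau1 * rho1 + tau2 * rho2) / tau2) := by positivity
  rw [hkey]
  exact ⟨fun h => mul_pos hc (sub_pos.2 h), fun h => mul_neg_of_pos_of_neg hc (sub_neg.2 h),
    fun h => by rw [sub_eq_zero.2 h, mul_zero]⟩
end

section
/- (Exponential convergence bounds in Π₃ and Π₄) Let y be a solution of the time-changed ODE and w₀ = τ₁y₁(0) + τ₂y₂(0). (i) If y(s) ∈ Π₃ for all s ∈ [0,t], then |y₂(t) − (ρ₂/ρ₁)K₁| ≤ |y₂(0) − (ρ₂/ρ₁)K₁|·e^{ξ₂₂ t}. (ii) If y(s) ∈ Π₄ for all s ∈ [0,t], then |y₂(t) − (ρ₂/ρ₁)(w₀/w*)K₁| ≤ (τ₁/τ₂)·|(w₀/w*)K₁ − y₁(0)|·e^{α₂ t}. Since ξ₂₂ < 0 and α₂ < 0, both bounds decay exponentially in t. -/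
open Set in
/-- A function with derivative `a (f - c)` on `[0, t]` is `c + (f 0 - c) exp (a t)`. -/
lemma sub_eq_mul_exp_of_hasDerivWithinAt {f : ℝ → ℝ} {a c t : ℝ} (ht : 0 ≤ t)
    (hf : ∀ s, 0 ≤ s → s ≤ t → HasDerivWithinAt f (a * (f s - c)) (Ici 0) s) :
    f t - c = (f 0 - c) * Real.exp (a * t) := by
  have hg : ∀ s, 0 ≤ s → s ≤ t →
      HasDerivWithinAt (fun s => (f s - c) * Real.exp (-(a * s))) 0 (Ici 0) s := by
    intro s h0 hs
    have he : HasDerivAt (fun s => Real.exp (-(a * s))) (Real.exp (-(a * s)) * -(a * 1)) s :=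
      (((hasDerivAt_id s).const_mul a).neg).exp
    refine (((hf s h0 hs).sub_const c).mul he.hasDerivWithinAt).congr_deriv ?_
    ring
  have h := constant_of_has_deriv_right_zero
    (fun s hs => (hg s hs.1 hs.2).continuousWithinAt.mono Icc_subset_Ici_self)
    (fun s hs => (hg s hs.1 hs.2.le).mono (Ici_subset_Ici.2 hs.1)) t ⟨ht, le_rfl⟩
  simp only [mul_zero, neg_zero, Real.exp_zero, mul_one] at h
  rw [← h, mul_assoc, ← Real.exp_add]
  simp

/-- If the powers of `P` tend to zero, `P` has no nonzero fixed vector. -/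
lemma Matrix.eq_zero_of_mulVec_eq_of_tendsto_pow {n : Type*} [Fintype n] [DecidableEq n]
    {P : Matrix n n ℝ} (hP : Filter.Tendsto (fun k : ℕ => P ^ k) Filter.atTop (nhds 0))
    {v : n → ℝ} (hv : P.mulVec v = v) : v = 0 := by
  have hk : ∀ k : ℕ, (P ^ k).mulVec v = v := by
    intro k
    induction k with
    | zero => simp
    | succ k ih => rw [pow_succ, ← Matrix.mulVec_mulVec, hv, ih]
  have hc : Continuous fun A : Matrix n n ℝ => A.mulVec v := by fun_prop
  have h := (hc.tendsto 0).comp hP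
  simp only [Function.comp_def, hk, Matrix.zero_mulVec] at h
  exact tendsto_nhds_unique tendsto_const_nhds h

/-- For a convergent substochastic `2 × 2` matrix `P`, the diagonal entries of `I - P` and its
determinant are positive. -/
lemma substochastic_two_pos {p11 p12 p21 p22 : ℝ}
    (hp12 : 0 ≤ p12) (hp21 : 0 ≤ p21)
    (hrow1 : p11 + p12 ≤ 1) (hrow2 : p21 + p22 ≤ 1)
    (hspec : Filter.Tendsto
      (fun k : ℕ => (Matrix.of ![![p11, p12], ![p21, p22]] : Matrix (Fin 2) (Fin 2) ℝ) ^ k)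
      Filter.atTop (nhds 0)) :
    0 < 1 - p11 ∧ 0 < 1 - p22 ∧ 0 < (1 - p11) * (1 - p22) - p12 * p21 := by
  have hdet : (1 - p11) * (1 - p22) - p12 * p21 ≠ 0 := by
    intro h0
    have hfix : ∀ a b : ℝ, p11 * a + p12 * b = a → p21 * a + p22 * b = b → a = 0 ∧ b = 0 := by
      intro a b ha hb
      have hv := Matrix.eq_zero_of_mulVec_eq_of_tendsto_pow hspec (v := ![a, b]) (by
        ext i
        fin_cases i <;> simp [Matrix.mulVec, dotProduct, Fin.sum_univ_two, ha, hb])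
      exact ⟨by simpa using congrFun hv 0, by simpa using congrFun hv 1⟩
    have h1 := hfix (1 - p22) p21 (by linarith) (by ring)
    have h2 := hfix p12 (1 - p11) (by ring) (by linarith)
    have h3 := hfix 1 1 (by linarith) (by linarith)
    linarith [h3.1]
  have hge : p12 * p21 ≤ (1 - p11) * (1 - p22) :=
    mul_le_mul (by linarith) (by linarith) hp21 (by linarith)
  have hpos : 0 < (1 - p11) * (1 - p22) - p12 * p21 :=
    lt_of_le_of_ne (by linarith) hdet.symm
  have hprod : 0 < (1 - p11) * (1 - p22) := by nlinarith [mul_nonneg hp12 hp21]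
  have h1 : 0 < 1 - p11 := lt_of_le_of_ne (by linarith) fun h => by
    rw [← h] at hprod; simp at hprod
  exact ⟨h1, pos_of_mul_pos_right hprod h1.le, hpos⟩

/-- A `2 × 2` linear system `x = b + A x` with `A ≥ 0`, `b > 0` and positive leading minors of
`I - A` has a positive solution. -/
lemma two_system_pos {a b c d x z u v : ℝ} (hd : 0 < 1 - d) (hb : 0 ≤ b)
    (hdet : 0 < (1 - a) * (1 - d) - b * c) (hu : 0 < u) (hv : 0 < v)
    (hx : x = u + a * x + b * z) (hz : z = v + c * x + d * z) : 0 < x := by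
  have h : ((1 - a) * (1 - d) - b * c) * x = u * (1 - d) + b * v := by
    linear_combination (1 - d) * hx + b * hz
  have : 0 < u * (1 - d) + b * v := add_pos_of_pos_of_nonneg (mul_pos hu hd) (mul_nonneg hb hv.le)
  rw [← h] at this
  exact pos_of_mul_pos_right this hdet.le

open Set in
lemma IsTCSolution.hasDerivWithinAt_fst {xi11 xi12 xi21 xi22 K1 K2 : ℝ} {y : ℝ → ℝ × ℝ}
    (hy : IsTCSolution xi11 xi12 xi21 xi22 K1 K2 y) {t : ℝ} (ht : 0 ≤ t) :
    HasDerivWithinAt (fun s => (y s).1)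
      (xi11 * min (y t).1 K1 + xi12 * min (y t).2 K2) (Ici 0) t := by
  simpa using (hy t ht).2.2.hasFDerivWithinAt.fst.hasDerivWithinAt

open Set in
lemma IsTCSolution.hasDerivWithinAt_snd {xi11 xi12 xi21 xi22 K1 K2 : ℝ} {y : ℝ → ℝ × ℝ}
    (hy : IsTCSolution xi11 xi12 xi21 xi22 K1 K2 y) {t : ℝ} (ht : 0 ≤ t) :
    HasDerivWithinAt (fun s => (y s).2)
      (xi21 * min (y t).1 K1 + xi22 * min (y t).2 K2) (Ici 0) t := by
  simpa using (hy t ht).2.2.hasFDerivWithinAt.snd.hasDerivWithinAt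

open Set in
/-- A linear functional annihilating the drift matrix is conserved along solutions. -/
lemma IsTCSolution.conserved {xi11 xi12 xi21 xi22 K1 K2 tau1 tau2 : ℝ} {y : ℝ → ℝ × ℝ}
    (hy : IsTCSolution xi11 xi12 xi21 xi22 K1 K2 y)
    (h1 : tau1 * xi11 + tau2 * xi21 = 0) (h2 : tau1 * xi12 + tau2 * xi22 = 0)
    {t : ℝ} (ht : 0 ≤ t) :
    tau1 * (y t).1 + tau2 * (y t).2 = tau1 * (y 0).1 + tau2 * (y 0).2 := by
  have h := sub_eq_mul_exp_of_hasDerivWithinAt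
    (f := fun s => tau1 * (y s).1 + tau2 * (y s).2) (a := 0) (c := 0) ht (by
      intro s h0 _
      refine (((hy.hasDerivWithinAt_fst h0).const_mul tau1).add
        ((hy.hasDerivWithinAt_snd h0).const_mul tau2)).congr_deriv ?_
      linear_combination (min (y s).1 K1) * h1 + min (y s).2 K2 * h2)
  simpa using h

/-- Exponential convergence bounds for the time-changed ODE in regions `Π₃` and `Π₄`. -/
theorem tc_ode_exponential_bounds
    (lam1 lam2 mu1 mu2 : ℝ)
    (hlam1 : 0 < lam1) (hlam2 : 0 < lam2) (hmu1 : 0 < mu1) (hmu2 : 0 < mu2)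
    (p11 p12 p21 p22 : ℝ)
    (hp11 : 0 ≤ p11) (hp12 : 0 ≤ p12) (hp21 : 0 ≤ p21) (hp22 : 0 ≤ p22)
    (hrow1 : p11 + p12 ≤ 1) (hrow2 : p21 + p22 ≤ 1)
    (hspec : Filter.Tendsto
      (fun k : ℕ => (Matrix.of ![![p11, p12], ![p21, p22]] : Matrix (Fin 2) (Fin 2) ℝ) ^ k)
      Filter.atTop (nhds 0))
    (gam1 gam2 : ℝ)
    (hgam1 : gam1 = lam1 + p11 * gam1 + p21 * gam2)
    (hgam2 : gam2 = lam2 + p12 * gam1 + p22 * gam2)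
    (rho1 rho2 : ℝ) (hrho1 : rho1 = gam1 / mu1) (hrho2 : rho2 = gam2 / mu2)
    (tau1 tau2 : ℝ)
    (htau1 : tau1 = 1 / mu1 + p11 * tau1 + p12 * tau2)
    (htau2 : tau2 = 1 / mu2 + p21 * tau1 + p22 * tau2)
    (hcrit : rho1 + rho2 = 1)
    (K1 K2 : ℝ) (hK1 : 0 < K1) (hK2 : 0 < K2)
    (hbot : rho1 / K1 > rho2 / K2)
    (xi11 xi12 xi21 xi22 : ℝ)
    (hxi11 : xi11 = lam1 + mu1 * p11 - mu1)
    (hxi12 : xi12 = lam1 + mu2 * p21)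
    (hxi21 : xi21 = lam2 + mu1 * p12)
    (hxi22 : xi22 = lam2 + mu2 * p22 - mu2)
    (alpha2 : ℝ) (halpha2 : alpha2 = xi11 + xi22)
    (wstar : ℝ) (hwstar : wstar = tau1 * K1 + tau2 * (rho2 / rho1) * K1)
    (y : ℝ → ℝ × ℝ) (hy : IsTCSolution xi11 xi12 xi21 xi22 K1 K2 y)
    (w0 : ℝ) (hw0 : w0 = tau1 * (y 0).1 + tau2 * (y 0).2)
    (t : ℝ) (ht : 0 ≤ t) :
    ((∀ s : ℝ, 0 ≤ s → s ≤ t → K1 ≤ (y s).1 ∧ (y s).2 ≤ K2) →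
      |(y t).2 - rho2 / rho1 * K1| ≤ |(y 0).2 - rho2 / rho1 * K1| * Real.exp (xi22 * t)) ∧
    ((∀ s : ℝ, 0 ≤ s → s ≤ t → (y s).1 ≤ K1 ∧ (y s).2 ≤ K2) →
      |(y t).2 - rho2 / rho1 * (w0 / wstar) * K1|
        ≤ tau1 / tau2 * |w0 / wstar * K1 - (y 0).1| * Real.exp (alpha2 * t)) ∧
    xi22 < 0 ∧ alpha2 < 0 := by
  obtain ⟨hq1, hq2, hdet⟩ := substochastic_two_pos hp12 hp21 hrow1 hrow2 hspec
  have hg1 : 0 < gam1 := two_system_pos hq2 hp21 (by linarith) hlam1 hlam2 hgam1 hgam2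
  have hg2 : 0 < gam2 :=
    two_system_pos hq1 hp12 (by linarith) hlam2 hlam1 (z := gam1) (a := p22) (c := p21) (d := p11)
      (by linarith) (by linarith)
  have hb1 : 0 < 1 / mu1 := by positivity
  have hb2 : 0 < 1 / mu2 := by positivity
  have ht1 : 0 < tau1 := two_system_pos hq2 hp12 hdet hb1 hb2 htau1 htau2
  have ht2 : 0 < tau2 :=
    two_system_pos hq1 hp21 (by linarith) hb2 hb1 (z := tau1) (a := p22) (c := p12) (d := p11)
      (by linarith) (by linarith)
  have hr1 : 0 < rho1 := hrho1 ▸ div_pos hg1 hmu1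
  have hr2 : 0 < rho2 := hrho2 ▸ div_pos hg2 hmu2
  have hm1 : mu1 * (1 / mu1) = 1 := by field_simp
  have hm2 : mu2 * (1 / mu2) = 1 := by field_simp
  have hgr1 : gam1 = mu1 * rho1 := by rw [hrho1]; field_simp
  have hgr2 : gam2 = mu2 * rho2 := by rw [hrho2]; field_simp
  have hlt : tau1 * lam1 + tau2 * lam2 = 1 := by
    linear_combination gam1 * htau1 + gam2 * htau2 - tau1 * hgam1 - tau2 * hgam2 + hcrit
      + (1 / mu1) * hgr1 + (1 / mu2) * hgr2 + rho1 * hm1 + rho2 * hm2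
  have hcol1 : tau1 * xi11 + tau2 * xi21 = 0 := by
    rw [hxi11, hxi21]
    linear_combination hlt - mu1 * htau1 - hm1
  have hcol2 : tau1 * xi12 + tau2 * xi22 = 0 := by
    rw [hxi12, hxi22]
    linear_combination hlt - mu2 * htau2 - hm2
  have hker : xi21 * rho1 + xi22 * rho2 = 0 := by
    rw [hxi21, hxi22]
    linear_combination lam2 * hcrit - p12 * hgr1 + (1 - p22) * hgr2 - hgam2
  have hx21 : 0 < xi21 := by rw [hxi21]; positivity
  have hx22 : xi22 < 0 := by
    by_contra! h
    linarith [mul_pos hx21 hr1, mul_nonneg h hr2.le]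
  have hx11 : xi11 < 0 := by
    by_contra! h
    linarith [mul_pos ht2 hx21, mul_nonneg ht1.le h]
  have hker' : xi21 = -(xi22 * (rho2 / rho1)) := by
    field_simp
    linarith
  refine ⟨fun hreg => ?_, fun hreg => ?_, hx22, by linarith⟩
  · have h := sub_eq_mul_exp_of_hasDerivWithinAt
      (f := fun s => (y s).2) (a := xi22) (c := rho2 / rho1 * K1) ht (by
        intro s h0 hs
        refine (hy.hasDerivWithinAt_snd h0).congr_deriv ?_
        rw [min_eq_right (hreg s h0 hs).1, min_eq_left (hreg s h0 hs).2, hker']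
        ring)
    rw [h, abs_mul, Real.abs_exp]
  · have hw : 0 < wstar := by rw [hwstar]; positivity
    set z := w0 / wstar * K1 with hz
    have hc : rho2 / rho1 * (w0 / wstar) * K1 = rho2 / rho1 * z := by rw [hz]; ring
    have hwz : tau1 * z + tau2 * (rho2 / rho1 * z) = w0 := by
      have : w0 / wstar * wstar = w0 := div_mul_cancel₀ _ hw.ne'
      rw [hz]
      linear_combination this - w0 / wstar * hwstar
    have h := sub_eq_mul_exp_of_hasDerivWithinAt
      (f := fun s => (y s).2) (a := alpha2) (c := rho2 / rho1 * z) ht (by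
        intro s h0 hs
        have hcons := hy.conserved hcol1 hcol2 h0
        refine (hy.hasDerivWithinAt_snd h0).congr_deriv ?_
        rw [min_eq_left (hreg s h0 hs).1, min_eq_left (hreg s h0 hs).2, halpha2]
        have hv : tau1 * ((y s).1 - z) + tau2 * ((y s).2 - rho2 / rho1 * z) = 0 := by
          linarith
        refine mul_left_cancel₀ ht1.ne' ?_
        linear_combination xi21 * hv + tau1 * z * hker' - ((y s).2 - rho2 / rho1 * z) * hcol1)
    have h0 : (y 0).2 - rho2 / rho1 * z = tau1 / tau2 * (z - (y 0).1) := by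
      rw [div_mul_eq_mul_div tau1, eq_div_iff ht2.ne']
      linear_combination -hwz - hw0
    rw [hc, h, h0, abs_mul, abs_mul, Real.abs_exp, abs_of_pos (div_pos ht1 ht2)]
end
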